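/- Let n ≥ 2 and let G₁,…,G_n be nontrivial finitely generated groups with finite generating sets S₁,…,S_n. Then there is a unique p₀ ∈ (0,1] satisfying Σ_{i=1}^n 1/χᵢ(p₀) = n − 1 (with the convention 1/∞ = 0; equivalently Σ_{j=1}^n Π_{i≠j} χᵢ(p₀) − (n−1)·Π_{i=1}^n χᵢ(p₀) = 0 when all χᵢ(p₀) are finite), and this p₀ equals the critical probability p_c of the Cayley graph of the free product G₁*…*G_n with respect to S₁ ⊔ … ⊔ S_n. -/

import Mathlib

open MeasureTheory ENNReal

namespace Perc

/-- Percolation configurations on the edge set `E`: each edge is `true` (open) or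
`false` (closed). -/
abbrev Config (E : Type*) := E → Bool

/-- `μ` is the Bernoulli product measure `P_p` with parameter `p` on `{0,1}^E`: the measure
of every finite cylinder event is the corresponding product.  (This determines `μ` uniquely
on the product σ-algebra, since cylinders form a π-system generating it.) -/
def IsBernoulli {E : Type*} (p : ℝ) (μ : Measure (Config E)) : Prop :=
  ∀ (F : Finset E) (σ : E → Bool),
    μ {ω | ∀ e ∈ F, ω e = σ e} =
      ∏ e ∈ F, ENNReal.ofReal (if σ e then p else 1 - p)

variable {G ι : Type*} [Group G]

/-- In the Cayley graph of `G` with edge set `G × ι`, where the edge `(a, i)` joins `a` and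
`a * f i` (the function `f : ι → G` lists the generators, with multiplicity), this says that
vertices `a` and `b` are joined by some open edge of the configuration `ω`. -/
def Step (f : ι → G) (ω : Config (G × ι)) (a b : G) : Prop :=
  ∃ i : ι, (ω (a, i) = true ∧ b = a * f i) ∨ (ω (b, i) = true ∧ a = b * f i)

/-- `x` and `y` are connected by a path of open edges (`x ↔ y`). -/
def Conn (f : ι → G) (ω : Config (G × ι)) (x y : G) : Prop :=
  Relation.ReflTransGen (Step f ω) x y

/-- The open cluster `C` of the identity. -/
def cluster (f : ι → G) (ω : Config (G × ι)) : Set G :=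
  {x | Conn f ω 1 x}

/-- The percolation function `θ`: the probability that the cluster of the identity is
infinite. -/
noncomputable def theta (f : ι → G) (μ : Measure (Config (G × ι))) : ℝ :=
  (μ {ω | (cluster f ω).Infinite}).toReal

/-- The expected cluster size `χ = E(|C|) ∈ [0,∞]` (where `|C| ∈ ℕ∞` is coerced
to `ℝ≥0∞`). -/
noncomputable def chi (f : ι → G) (μ : Measure (Config (G × ι))) : ℝ≥0∞ :=
  ∫⁻ ω, ((cluster f ω).encard : ℝ≥0∞) ∂μ

/-- The critical probability `p_c = inf {p ∈ [0,1] | θ(p) > 0}`, with the convention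
`p_c = 1` if `θ` vanishes on `[0,1]`; here `μ p` is the percolation measure at
parameter `p`. -/
noncomputable def pc (f : ι → G) (μ : ℝ → Measure (Config (G × ι))) : ℝ :=
  sInf ({p | p ∈ Set.Icc (0 : ℝ) 1 ∧ 0 < theta f (μ p)} ∪ {1})

/-- The word metric on `G` with respect to the generators `f i`: the length of a shortest
word in the generators and their inverses taking `x` to `y`.  (When the generators generate
`G`, this is the graph distance in the Cayley graph.) -/
noncomputable def wdist (f : ι → G) (x y : G) : ℕ :=
  sInf {n : ℕ | ∃ l : List G, l.length = n ∧
    (∀ g ∈ l, (∃ i, f i = g) ∨ (∃ i, (f i)⁻¹ = g)) ∧ x * l.prod = y}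

/-- Schonmann's critical point
`p_exp = sup {p ∈ [0,1] | ∃ c > 0, γ > 0, ∀ x y, P_p(x ↔ y) ≤ c·exp(-γ·dist(x,y))}`. -/
noncomputable def pexp (f : ι → G) (μ : ℝ → Measure (Config (G × ι))) : ℝ :=
  sSup {p | p ∈ Set.Icc (0 : ℝ) 1 ∧ ∃ c > 0, ∃ γ > 0, ∀ x y : G,
    (μ p {ω | Conn f ω x y}).toReal ≤ c * Real.exp (-γ * (wdist f x y : ℝ))}

/-- The walk-through function `g(p,t) = 1 - ∑_{n≥1} (1-t)^{n-1} P_p(|C| = n)` of a Cayley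
graph; here `μ` is the percolation measure at parameter `p`. -/
noncomputable def wt (f : ι → G) (μ : Measure (Config (G × ι))) (t : ℝ) : ℝ :=
  1 - ∑' n : ℕ, (1 - t) ^ n * (μ {ω | (cluster f ω).encard = ((n + 1 : ℕ) : ℕ∞)}).toReal

/-- The ball of radius `j`: all products of at most `j` elements of `S ∪ S⁻¹`. -/
def ball (S : Set G) (j : ℕ) : Set G :=
  {g | ∃ l : List G, l.length ≤ j ∧ (∀ x ∈ l, x ∈ S ∨ x⁻¹ ∈ S) ∧ l.prod = g}

/-- The Cheeger constant `h = inf_K |∂K| / |K|`, the infimum over nonempty finite vertex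
sets `K` of the number of edges `(a, i)` (joining `a` and `a * f i`) with exactly one
endpoint in `K`, divided by `|K|`. -/
noncomputable def cheeger (f : ι → G) : ℝ :=
  ⨅ K : {K : Finset G // K.Nonempty},
    (Nat.card {e : G × ι // Xor' (e.1 ∈ K.1) (e.1 * f e.2 ∈ K.1)} : ℝ) / (K.1.card : ℝ)

/-- The open cluster of the identity in the subgraph induced on the vertex set `V`: only
open edges with both endpoints in `V` may be used. -/
def clusterIn (f : ι → G) (V : Set G) (ω : Config (G × ι)) : Set G :=
  {x | Relation.ReflTransGen (fun a b => Step f ω a b ∧ a ∈ V ∧ b ∈ V) 1 x}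

/-- The generators of `G` given by a generating set `S` (one edge orbit per element
of `S`). -/
def setGens (S : Set G) : S → G := Subtype.val

/-- The generators of the free product `G₁ * G₂` given by the disjoint union `S₁ ⊔ S₂` of
generating sets, embedded via the canonical monomorphisms. -/
def coprodGens {G₁ G₂ : Type*} [Group G₁] [Group G₂] (S₁ : Set G₁) (S₂ : Set G₂) :
    S₁ ⊕ S₂ → Monoid.Coprod G₁ G₂ :=
  Sum.elim (fun s => Monoid.Coprod.inl (s : G₁)) (fun s => Monoid.Coprod.inr (s : G₂))

/-- The generators of the free product `G₁ * ⋯ * G_n` given by the disjoint union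
`S₁ ⊔ ⋯ ⊔ S_n` of generating sets, embedded via the canonical monomorphisms. -/
def coprodIGens {n : ℕ} {G : Fin n → Type*} [∀ i, Group (G i)] (S : ∀ i, Set (G i)) :
    (Σ i, S i) → Monoid.CoprodI G :=
  fun x => Monoid.CoprodI.of (x.2 : G x.1)

/-- The image of a list of syllables in the free product `G₁ * G₂`. -/
def sylProd {G₁ G₂ : Type*} [Group G₁] [Group G₂] (l : List (G₁ ⊕ G₂)) :
    Monoid.Coprod G₁ G₂ :=
  (l.map (Sum.elim (fun g => Monoid.Coprod.inl g) (fun h => Monoid.Coprod.inr h))).prod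

/-- The set `P₁` of nontrivial elements of `G₁ * G₂` whose normal form begins with a
nontrivial syllable of `G₁`: elements represented by a nonempty alternating product of
nontrivial syllables, the first syllable lying in `G₁`.  (Such a representation is the
normal form, which is unique.) -/
def beginsLeft {G₁ G₂ : Type*} [Group G₁] [Group G₂] (x : Monoid.Coprod G₁ G₂) : Prop :=
  ∃ l : List (G₁ ⊕ G₂), l ≠ [] ∧ (∀ a ∈ l, a ≠ Sum.inl 1 ∧ a ≠ Sum.inr 1) ∧
    l.Chain' (fun a b => a.isLeft ≠ b.isLeft) ∧
    (∃ g : G₁, l.head? = some (Sum.inl g)) ∧ sylProd l = x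

/-- The set `P₂` of nontrivial elements of `G₁ * G₂` whose normal form begins with a
nontrivial syllable of `G₂`. -/
def beginsRight {G₁ G₂ : Type*} [Group G₁] [Group G₂] (x : Monoid.Coprod G₁ G₂) : Prop :=
  ∃ l : List (G₁ ⊕ G₂), l ≠ [] ∧ (∀ a ∈ l, a ≠ Sum.inl 1 ∧ a ≠ Sum.inr 1) ∧
    l.Chain' (fun a b => a.isLeft ≠ b.isLeft) ∧
    (∃ h : G₂, l.head? = some (Sum.inr h)) ∧ sylProd l = x

end Perc

open Perc

namespace Perc

open ProbabilityTheory Set Filter Topology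

section Bernoulli

variable {I : Type*}

/-- The law of a single edge: `true` with probability `p`. -/
noncomputable def edgeLaw (p : ℝ) : Measure Bool :=
  ENNReal.ofReal p • Measure.dirac true + ENNReal.ofReal (1 - p) • Measure.dirac false

lemma edgeLaw_singleton (p : ℝ) (b : Bool) :
    edgeLaw p {b} = ENNReal.ofReal (if b then p else 1 - p) := by
  cases b <;> simp [edgeLaw]

lemma isProbabilityMeasure_edgeLaw {p : ℝ} (hp : p ∈ Icc (0 : ℝ) 1) :
    IsProbabilityMeasure (edgeLaw p) := by
  refine ⟨?_⟩
  simp only [edgeLaw, Measure.coe_add, Measure.coe_smul, Pi.add_apply, Pi.smul_apply, measure_univ,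
    smul_eq_mul, mul_one]
  rw [← ENNReal.ofReal_add hp.1 (by linarith [hp.2])]
  simp

lemma IsBernoulli.eq_infinitePi {p : ℝ} {μ : Measure (Config I)} (hμ : IsBernoulli p μ)
    [IsProbabilityMeasure (edgeLaw p)] :
    μ = Measure.infinitePi fun _ : I => edgeLaw p := by
  refine IsProjectiveLimit.unique (P := fun J => Measure.pi fun _ : J => edgeLaw p) ?_
    (Measure.isProjectiveLimit_infinitePi _)
  intro J
  refine Measure.ext_of_singleton fun a => ?_
  rw [Measure.pi_singleton, Measure.map_apply (by fun_prop) (measurableSet_singleton a)]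
  classical
  have h := hμ J (fun e => if h : e ∈ J then a ⟨e, h⟩ else true)
  convert h using 1
  · congr 1
    ext ω
    simp only [mem_preimage, mem_singleton_iff, funext_iff]
    constructor
    · intro h e he
      simpa [he] using h ⟨e, he⟩
    · intro h e
      simpa using h e e.2
  · rw [← Finset.prod_attach J]
    simp [edgeLaw_singleton]

lemma IsBernoulli.unique {p : ℝ} (hp : p ∈ Icc (0 : ℝ) 1) {μ ν : Measure (Config I)}
    (hμ : IsBernoulli p μ) (hν : IsBernoulli p ν) : μ = ν := by
  have := isProbabilityMeasure_edgeLaw hp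
  rw [hμ.eq_infinitePi, hν.eq_infinitePi]

lemma IsBernoulli.isProbabilityMeasure {p : ℝ} {μ : Measure (Config I)}
    (hμ : IsBernoulli p μ) : IsProbabilityMeasure μ := by
  refine ⟨?_⟩
  have := hμ ∅ (fun _ => true)
  simpa using this

lemma IsBernoulli.iIndepFun {p : ℝ} (hp : p ∈ Icc (0 : ℝ) 1) {μ : Measure (Config I)}
    (hμ : IsBernoulli p μ) : iIndepFun (fun (i : I) (ω : Config I) => ω i) μ := by
  have := isProbabilityMeasure_edgeLaw hp
  rw [hμ.eq_infinitePi]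
  exact iIndepFun_infinitePi (X := fun _ ω => ω) (fun _ => measurable_id)

lemma measurable_reindex {J : Type*} (φ : J → I) :
    Measurable (fun (ω : Config I) (j : J) => ω (φ j)) := by fun_prop

lemma IsBernoulli.map_reindex {J : Type*} {p : ℝ} {μ : Measure (Config I)}
    (hμ : IsBernoulli p μ) {φ : J → I} (hφ : Function.Injective φ) :
    IsBernoulli p (μ.map fun ω j => ω (φ j)) := by
  classical
  intro F σ
  have hm : MeasurableSet {ω : Config J | ∀ e ∈ F, ω e = σ e} := by
    have : {ω : Config J | ∀ e ∈ F, ω e = σ e} = ⋂ e ∈ F, (fun ω : Config J => ω e) ⁻¹' {σ e} := by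
      ext; simp
    rw [this]
    exact F.measurableSet_biInter fun e _ => measurable_pi_apply e (measurableSet_singleton _)
  rw [Measure.map_apply (measurable_reindex φ) hm]
  rcases isEmpty_or_nonempty J with hJ | hJ
  · have hF : F = ∅ := Finset.eq_empty_of_isEmpty F
    subst hF
    have := hμ.isProbabilityMeasure
    simp
  have h := hμ (F.image φ) (fun i => σ (Function.invFun φ i))
  rw [Finset.prod_image hφ.injOn] at h
  simp only [Function.leftInverse_invFun hφ _] at h
  rw [← h]
  congr 1
  ext ω
  simp [Function.leftInverse_invFun hφ _]

end Bernoulli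

section Independence

variable {I : Type*}

lemma measurableSet_of_dependsOn {P : Config I → Prop} {X : Set I}
    (hm : MeasurableSet {ω | P ω}) (hd : DependsOn P X) :
    MeasurableSet[⨆ i ∈ X, MeasurableSpace.comap (fun ω : Config I => ω i) inferInstance]
      {ω | P ω} := by
  classical
  let fill : Config I → Config I := fun ω i => if i ∈ X then ω i else false
  have hf : @Measurable _ _ (⨆ i ∈ X, MeasurableSpace.comap (fun ω : Config I => ω i) inferInstance)
      _ fill := by
    refine @measurable_pi_lambda _ _ _ (_) _ _ fun i => ?_
    by_cases hi : i ∈ X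
    · simp only [fill, hi, if_true]
      intro s hs
      exact (le_iSup₂_of_le (f := fun i (_ : i ∈ X) =>
        MeasurableSpace.comap (fun ω : Config I => ω i) inferInstance) i hi le_rfl) _ ⟨s, hs, rfl⟩
    · simp only [fill, hi, if_false]
      exact @measurable_const _ _ _ (_) _
  have : {ω | P ω} = fill ⁻¹' {ω | P ω} := by
    ext ω
    have := hd (x := ω) (y := fill ω) (fun i hi => by simp [fill, hi])
    simp [this]
  rw [this]
  exact hf hm

lemma measure_and_of_dependsOn {μ : Measure (Config I)}
    (hμ : iIndepFun (fun (i : I) (ω : Config I) => ω i) μ) {P Q : Config I → Prop} {X Y : Set I}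
    (hXY : Disjoint X Y) (hP : MeasurableSet {ω | P ω}) (hQ : MeasurableSet {ω | Q ω})
    (hPX : DependsOn P X) (hQY : DependsOn Q Y) :
    μ {ω | P ω ∧ Q ω} = μ {ω | P ω} * μ {ω | Q ω} := by
  have h := indep_iSup_of_disjoint (m := fun i =>
    MeasurableSpace.comap (fun ω : Config I => ω i) inferInstance)
    (fun i => (measurable_pi_apply i).comap_le) hμ.iIndep hXY
  rw [Indep_iff] at h
  exact h _ _ (measurableSet_of_dependsOn hP hPX) (measurableSet_of_dependsOn hQ hQY)

lemma measurableSet_finset_forall {Ω κ : Type*} [MeasurableSpace Ω] {P : κ → Ω → Prop}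
    (h : ∀ q, MeasurableSet {ω | P q ω}) (Q : Finset κ) : MeasurableSet {ω | ∀ q ∈ Q, P q ω} := by
  have : {ω | ∀ q ∈ Q, P q ω} = ⋂ q ∈ Q, {ω | P q ω} := by ext; simp
  rw [this]
  exact Q.measurableSet_biInter fun q _ => h q

lemma measure_forall_of_dependsOn {κ : Type*} {μ : Measure (Config I)} [IsProbabilityMeasure μ]
    (hμ : iIndepFun (fun (i : I) (ω : Config I) => ω i) μ) {P : κ → Config I → Prop}
    {X : κ → Set I} (hP : ∀ q, MeasurableSet {ω | P q ω}) (hPX : ∀ q, DependsOn (P q) (X q))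
    (Q : Finset κ) (hX : (Q : Set κ).PairwiseDisjoint X) :
    μ {ω | ∀ q ∈ Q, P q ω} = ∏ q ∈ Q, μ {ω | P q ω} := by
  classical
  induction Q using Finset.induction_on with
  | empty => simp
  | insert a Q ha ih =>
    rw [Finset.prod_insert ha, ← ih (hX.subset (by simp))]
    have : {ω | ∀ q ∈ insert a Q, P q ω} = {ω | P a ω ∧ ∀ q ∈ Q, P q ω} := by
      ext; simp
    rw [this]
    refine measure_and_of_dependsOn hμ (X := X a) (Y := ⋃ q ∈ Q, X q) ?_ (hP a)
      (measurableSet_finset_forall hP Q) (hPX a) ?_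
    · simp only [disjoint_iUnion_right]
      intro q hq
      exact hX (by simp) (by simp [hq]) (by rintro rfl; exact ha hq)
    · intro x y hxy
      simp only [eq_iff_iff]
      refine forall₂_congr fun q hq => ?_
      rw [hPX q fun i hi => hxy i (mem_biUnion hq hi)]

end Independence

section Cayley

variable {G ι : Type*} [Group G]

lemma measurableSet_reflTransGen {Ω α : Type*} [MeasurableSpace Ω] [Countable α]
    {R : Ω → α → α → Prop} (hR : ∀ a b, MeasurableSet {ω | R ω a b}) (a b : α) :
    MeasurableSet {ω | Relation.ReflTransGen (R ω) a b} := by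
  let reach : ℕ → α → Set Ω := fun n => Nat.rec (fun b => {_ω | a = b})
    (fun _ r b => ⋃ c, r c ∩ {ω | R ω c b}) n
  have hreach : ∀ n b, MeasurableSet (reach n b) := by
    intro n
    induction n with
    | zero => intro b; exact MeasurableSet.const _
    | succ n ih => intro b; exact MeasurableSet.iUnion fun c => (ih c).inter (hR c b)
  have : {ω | Relation.ReflTransGen (R ω) a b} = ⋃ n, reach n b := by
    ext ω
    simp only [mem_ofPred_eq, mem_iUnion]
    constructor
    · intro h
      induction h with
      | refl => exact ⟨0, rfl⟩
      | tail _ h ih =>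
        obtain ⟨n, hn⟩ := ih
        exact ⟨n + 1, mem_iUnion.2 ⟨_, hn, h⟩⟩
    · rintro ⟨n, hn⟩
      induction n generalizing b with
      | zero => obtain rfl : a = b := hn; exact .refl
      | succ n ih =>
        obtain ⟨c, hc, hcb⟩ := mem_iUnion.1 hn
        exact (ih c hc).tail hcb
  rw [this]
  exact MeasurableSet.iUnion fun n => hreach n b

/-- Connection by open edges having both endpoints in `V`. -/
def ConnIn (f : ι → G) (V : Set G) (ω : Config (G × ι)) (x y : G) : Prop :=
  Relation.ReflTransGen (fun a b => Step f ω a b ∧ a ∈ V ∧ b ∈ V) x y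

lemma measurableSet_open {I : Type*} (e : I) : MeasurableSet {ω : Config I | ω e = true} :=
  (measurable_pi_apply e : Measurable fun ω : Config I => ω e) (measurableSet_singleton true)

lemma measurableSet_step [Countable ι] (f : ι → G) (a b : G) :
    MeasurableSet {ω | Step f ω a b} := by
  have : {ω | Step f ω a b} = ⋃ i, (({ω : Config (G × ι) | ω (a, i) = true} ∩ {_ω | b = a * f i}) ∪
      ({ω : Config (G × ι) | ω (b, i) = true} ∩ {_ω | a = b * f i})) := by
    ext ω; simp [Step]
  rw [this]
  exact MeasurableSet.iUnion fun i => ((measurableSet_open _).inter (MeasurableSet.const _)).union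
    ((measurableSet_open _).inter (MeasurableSet.const _))

section Measurable

variable [Countable G] [Countable ι]

lemma measurableSet_conn (f : ι → G) (x y : G) : MeasurableSet {ω | Conn f ω x y} :=
  measurableSet_reflTransGen (measurableSet_step f) x y

lemma measurableSet_connIn (f : ι → G) (V : Set G) (x y : G) :
    MeasurableSet {ω | ConnIn f V ω x y} :=
  measurableSet_reflTransGen
    (fun a b => (measurableSet_step f a b).inter (MeasurableSet.const (a ∈ V ∧ b ∈ V))) x y

end Measurable

lemma ConnIn.mono {f : ι → G} {V W : Set G} (h : V ⊆ W) {ω : Config (G × ι)} {x y : G}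
    (hc : ConnIn f V ω x y) : ConnIn f W ω x y :=
  Relation.ReflTransGen.mono (fun _ _ hab => ⟨hab.1, h hab.2.1, h hab.2.2⟩) _ _ hc

lemma ConnIn.conn {f : ι → G} {V : Set G} {ω : Config (G × ι)} {x y : G}
    (hc : ConnIn f V ω x y) : Conn f ω x y :=
  Relation.ReflTransGen.mono (fun _ _ hab => hab.1) _ _ hc

lemma ConnIn.mem {f : ι → G} {V : Set G} {ω : Config (G × ι)} {x y : G}
    (hc : ConnIn f V ω x y) (hx : x ∈ V) : y ∈ V := by
  cases hc with
  | refl => exact hx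
  | tail _ h => exact h.2.2

lemma Conn.exists_connIn {f : ι → G} {ω : Config (G × ι)} {x y : G}
    (hc : Conn f ω x y) : ∃ V : Finset G, ConnIn f (V : Set G) ω x y := by
  classical
  induction hc with
  | refl => exact ⟨∅, .refl⟩
  | @tail b c _ h ih =>
    obtain ⟨V, hV⟩ := ih
    exact ⟨insert b (insert c V), (hV.mono (by intro; simp +contextual)).tail
      ⟨h, by simp, by simp⟩⟩

lemma Step.mono {f : ι → G} {ω ω' : Config (G × ι)} (h : ∀ e, ω e = true → ω' e = true) {a b : G}
    (hs : Step f ω a b) : Step f ω' a b := by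
  obtain ⟨i, h1 | h1⟩ := hs
  · exact ⟨i, .inl ⟨h _ h1.1, h1.2⟩⟩
  · exact ⟨i, .inr ⟨h _ h1.1, h1.2⟩⟩

lemma Conn.mono {f : ι → G} {ω ω' : Config (G × ι)} (h : ∀ e, ω e = true → ω' e = true) {a b : G}
    (hs : Conn f ω a b) : Conn f ω' a b :=
  Relation.ReflTransGen.mono (fun _ _ => Step.mono h) _ _ hs

/-- The configuration `ω` seen from the vertex `a`. -/
def shift (a : G) (ω : Config (G × ι)) : Config (G × ι) := fun e => ω (a * e.1, e.2)

lemma shift_one (ω : Config (G × ι)) : shift 1 ω = ω := by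
  funext e; simp [shift]

lemma shift_shift (a b : G) (ω : Config (G × ι)) : shift a (shift b ω) = shift (b * a) ω := by
  funext e; simp [shift, mul_assoc]

lemma measurable_shift (a : G) : Measurable (shift a : Config (G × ι) → Config (G × ι)) :=
  measurable_reindex _

lemma step_shift {f : ι → G} {a : G} {ω : Config (G × ι)} {x y : G} :
    Step f (shift a ω) x y ↔ Step f ω (a * x) (a * y) := by
  simp [Step, shift, mul_assoc]

lemma conn_shift {f : ι → G} {a : G} {ω : Config (G × ι)} {x y : G} :
    Conn f (shift a ω) x y ↔ Conn f ω (a * x) (a * y) := by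
  have key : ∀ (a : G) (ω : Config (G × ι)) (x y : G),
      Conn f (shift a ω) x y → Conn f ω (a * x) (a * y) := fun a ω x y h =>
    Relation.ReflTransGen.lift (a * ·) (fun _ _ => step_shift.1) _ _ h
  refine ⟨key a ω x y, fun h => ?_⟩
  have := key a⁻¹ (shift a ω) (a * x) (a * y) (by rwa [shift_shift, mul_inv_cancel, shift_one])
  simpa using this

lemma IsBernoulli.measure_shift {p : ℝ} (hp : p ∈ Icc (0 : ℝ) 1) {μ : Measure (Config (G × ι))}
    (hμ : IsBernoulli p μ) (a : G) {P : Config (G × ι) → Prop} (hP : MeasurableSet {ω | P ω}) :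
    μ {ω | P (shift a ω)} = μ {ω | P ω} := by
  have hinj : Function.Injective (fun e : G × ι => (a * e.1, e.2)) := by
    intro e e' h
    simp only [Prod.mk.injEq, mul_right_inj] at h
    exact Prod.ext h.1 h.2
  have : μ.map (shift a) = μ := (hμ.map_reindex hinj).unique hp hμ
  conv_rhs => rw [← this, Measure.map_apply (measurable_shift a) hP]
  rfl

lemma IsBernoulli.measure_conn [Countable G] [Countable ι] {p : ℝ} (hp : p ∈ Icc (0 : ℝ) 1)
    {μ : Measure (Config (G × ι))} (hμ : IsBernoulli p μ) (f : ι → G) (x y : G) :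
    μ {ω | Conn f ω x y} = μ {ω | Conn f ω 1 (x⁻¹ * y)} := by
  rw [← hμ.measure_shift hp x (measurableSet_conn f 1 (x⁻¹ * y))]
  simp [conn_shift]

lemma chi_eq_tsum [Countable G] [Countable ι] (f : ι → G) (μ : Measure (Config (G × ι))) :
    chi f μ = ∑' x, μ {ω | Conn f ω 1 x} := by
  have h : ∀ ω : Config (G × ι), ((cluster f ω).encard : ℝ≥0∞) =
      ∑' x, ({ω | Conn f ω 1 x} : Set (Config (G × ι))).indicator (fun _ => (1 : ℝ≥0∞)) ω := by
    intro ω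
    rw [← ENNReal.tsum_set_one, tsum_subtype (cluster f ω) (fun _ => (1 : ℝ≥0∞))]
    rfl
  simp only [chi, h]
  rw [lintegral_tsum fun x => (measurable_const.indicator (measurableSet_conn f 1 x)).aemeasurable]
  exact tsum_congr fun x => by
    rw [lintegral_indicator (measurableSet_conn f 1 x)]
    simp

lemma one_le_chi [Countable G] [Countable ι] (f : ι → G) (μ : Measure (Config (G × ι)))
    [IsProbabilityMeasure μ] : 1 ≤ chi f μ := by
  rw [chi_eq_tsum]
  refine le_trans ?_ (ENNReal.le_tsum 1)
  have : {ω | Conn f ω 1 1} = univ := eq_univ_of_forall fun ω => Relation.ReflTransGen.refl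
  rw [this, measure_univ]

lemma sum_measure_conn_le_chi [Countable G] [Countable ι] {p : ℝ} (hp : p ∈ Icc (0 : ℝ) 1)
    {μ : Measure (Config (G × ι))} (hμ : IsBernoulli p μ) (f : ι → G) (x : G) (V : Finset G) :
    ∑ y ∈ V, μ {ω | Conn f ω x y} ≤ chi f μ := by
  rw [chi_eq_tsum]
  simp only [hμ.measure_conn hp f x]
  refine (ENNReal.sum_le_tsum V).trans ?_
  exact ENNReal.tsum_comp_le_tsum_of_injective (mul_right_injective x⁻¹)
    fun y => μ {ω | Conn f ω 1 y}

lemma exists_finset_conn (f : ι → G) (hf : Subgroup.closure (range f) = ⊤) (x : G) :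
    ∃ F : Finset (G × ι), ∀ ω : Config (G × ι), (∀ e ∈ F, ω e = true) → Conn f ω 1 x := by
  classical
  have hx : x ∈ Subgroup.closure (range f) := by rw [hf]; trivial
  induction hx using Subgroup.closure_induction_right with
  | one => exact ⟨∅, fun ω _ => .refl⟩
  | mul_right x hx s hs ih =>
    obtain ⟨F, hF⟩ := ih
    obtain ⟨i, rfl⟩ := hs
    refine ⟨insert (x, i) F, fun ω h => (hF ω fun e he => h e (by simp [he])).tail ⟨i, .inl ?_⟩⟩
    exact ⟨h _ (by simp), rfl⟩
  | mul_inv_cancel x hx s hs ih =>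
    obtain ⟨F, hF⟩ := ih
    obtain ⟨i, rfl⟩ := hs
    refine ⟨insert (x * (f i)⁻¹, i) F, fun ω h =>
      (hF ω fun e he => h e (by simp [he])).tail ⟨i, .inr ?_⟩⟩
    exact ⟨h _ (by simp), by simp⟩

lemma exists_pow_le_measure_conn (f : ι → G) (hf : Subgroup.closure (range f) = ⊤) (x : G) :
    ∃ n : ℕ, ∀ (p : ℝ) (μ : Measure (Config (G × ι))), IsBernoulli p μ →
      ENNReal.ofReal p ^ n ≤ μ {ω | Conn f ω 1 x} := by
  obtain ⟨F, hF⟩ := exists_finset_conn f hf x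
  refine ⟨F.card, fun p μ hμ => ?_⟩
  have := hμ F fun _ => true
  simp only [if_true, Finset.prod_const] at this
  rw [← this]
  exact measure_mono fun ω h => hF ω h

lemma countable_of_closure_range_eq_top [Countable ι] (f : ι → G)
    (hf : Subgroup.closure (range f) = ⊤) : Countable G := by
  refine Function.Surjective.countable (f := fun w : FreeGroup ι => FreeGroup.lift f w) ?_
  rw [← MonoidHom.range_eq_top, FreeGroup.range_lift_eq_closure, hf]

end Cayley

section Sprinkling

/-- The first of two independent configurations. -/
def base {E : Type*} (ω : Config (E ⊕ E)) : Config E := fun e => ω (.inl e)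

/-- The union of two independent configurations. -/
def sprinkled {E : Type*} (ω : Config (E ⊕ E)) : Config E := fun e => ω (.inl e) || ω (.inr e)

lemma measurable_base {E : Type*} : Measurable (base : Config (E ⊕ E) → Config E) :=
  measurable_reindex _

lemma measurable_sprinkled {E : Type*} : Measurable (sprinkled : Config (E ⊕ E) → Config E) := by
  refine measurable_pi_lambda _ fun e => ?_
  have : Measurable fun b : Bool × Bool => b.1 || b.2 := Measurable.of_discrete
  have h2 : Measurable fun ω : Config (E ⊕ E) => (ω (.inl e), ω (.inr e)) := by fun_prop
  exact this.comp h2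

/-- A measure on pairs of configurations sprinkling percolation of parameter `p` with edges of
density `(p' - p) / (1 - p)` to get percolation of parameter `p'`. -/
structure IsSprinkling {E : Type*} (p p' : ℝ) (ν : Measure (Config (E ⊕ E))) : Prop where
  isProbabilityMeasure : IsProbabilityMeasure ν
  iIndepFun : iIndepFun (fun (e : E ⊕ E) (ω : Config (E ⊕ E)) => ω e) ν
  inr_open : ∀ e, ν {ω | ω (.inr e) = true} = ENNReal.ofReal ((p' - p) / (1 - p))
  base_bernoulli : IsBernoulli p (ν.map base)
  sprinkled_bernoulli : IsBernoulli p' (ν.map sprinkled)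

lemma measurableSet_forall_eq {E : Type*} (F : Finset E) (σ : E → Bool) :
    MeasurableSet {ω : Config E | ∀ e ∈ F, ω e = σ e} :=
  measurableSet_finset_forall (P := fun e (ω : Config E) => ω e = σ e)
    (fun e => (measurable_pi_apply e : Measurable fun ω : Config E => ω e)
      (measurableSet_singleton _)) F

lemma exists_isSprinkling (E : Type*) {p p' : ℝ} (h0 : 0 ≤ p) (hpp : p ≤ p') (h1 : p < 1)
    (h1' : p' ≤ 1) : ∃ ν : Measure (Config (E ⊕ E)), IsSprinkling p p' ν := by
  set q := (p' - p) / (1 - p) with hq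
  have h1p : 0 < 1 - p := by linarith
  have hq0 : 0 ≤ q := div_nonneg (by linarith) h1p.le
  have hq1 : q ≤ 1 := by rw [hq, div_le_one h1p]; linarith
  have hcomb : 1 - p' = (1 - p) * (1 - q) := by
    rw [hq]; field_simp; ring
  let law : E ⊕ E → Measure Bool := Sum.elim (fun _ => edgeLaw p) (fun _ => edgeLaw q)
  have hlaw : ∀ e, IsProbabilityMeasure (law e) := by
    rintro (e | e)
    · exact isProbabilityMeasure_edgeLaw ⟨h0, h1.le⟩
    · exact isProbabilityMeasure_edgeLaw ⟨hq0, hq1⟩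
  let ν := Measure.infinitePi law
  have hind : iIndepFun (fun (e : E ⊕ E) (ω : Config (E ⊕ E)) => ω e) ν :=
    iIndepFun_infinitePi (X := fun _ ω => ω) (fun _ => measurable_id)
  have hmarg : ∀ e b, ν {ω | ω e = b} = law e {b} := by
    intro e b
    rw [← Measure.infinitePi_map_eval law e,
      Measure.map_apply (measurable_pi_apply e) (measurableSet_singleton b)]
    rfl
  have hmeas : ∀ (e : E ⊕ E) b, MeasurableSet {ω : Config (E ⊕ E) | ω e = b} := fun e b =>
    (measurable_pi_apply e : Measurable fun ω : Config (E ⊕ E) => ω e) (measurableSet_singleton b)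
  have hsm : ∀ (e : E) b, MeasurableSet {ω : Config (E ⊕ E) | sprinkled ω e = b} := fun e b =>
    ((measurable_pi_apply e : Measurable fun ω : Config E => ω e).comp measurable_sprinkled)
      (measurableSet_singleton b)
  refine ⟨ν, inferInstance, hind, fun e => ?_, ?_, ?_⟩
  · rw [hmarg]
    simp [law, edgeLaw_singleton, hq]
  · intro F σ
    rw [Measure.map_apply measurable_base (measurableSet_forall_eq F σ)]
    have := measure_forall_of_dependsOn (κ := E) hind (P := fun e ω => ω (.inl e) = σ e)
      (X := fun e => {.inl e}) (fun e => hmeas _ _) (fun e x y h => by simp [h (.inl e) rfl])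
      F (fun a _ b _ hab => by simpa [eq_comm] using hab)
    simp only [hmarg, law, Sum.elim_inl, edgeLaw_singleton] at this
    exact this
  · intro F σ
    rw [Measure.map_apply measurable_sprinkled (measurableSet_forall_eq F σ)]
    have := measure_forall_of_dependsOn (κ := E) hind (P := fun e ω => sprinkled ω e = σ e)
      (X := fun e => {.inl e, .inr e}) (fun e => hsm _ _)
      (fun e x y h => by simp [sprinkled, h (.inl e) (by simp), h (.inr e) (by simp)])
      F (fun a _ b _ hab => by simpa [eq_comm] using hab)
    refine Eq.trans this (Finset.prod_congr rfl fun e _ => ?_)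
    have hfalse : ν {ω | sprinkled ω e = false} = ENNReal.ofReal (1 - p') := by
      have h := measure_and_of_dependsOn hind (P := fun ω => ω (.inl e) = false)
        (Q := fun ω => ω (.inr e) = false) (X := {.inl e}) (Y := {.inr e}) (by simp)
        (hmeas _ _) (hmeas _ _) (fun x y h => by simp [h (.inl e) rfl])
        (fun x y h => by simp [h (.inr e) rfl])
      rw [hmarg, hmarg] at h
      simp only [law, Sum.elim_inl, Sum.elim_inr, edgeLaw_singleton] at h
      rw [hcomb, ENNReal.ofReal_mul h1p.le]
      simpa [sprinkled] using h
    cases σ e with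
    | false => simpa using hfalse
    | true =>
      have : {ω : Config (E ⊕ E) | sprinkled ω e = true} = {ω | sprinkled ω e = false}ᶜ := by
        ext; simp
      rw [this, prob_compl_eq_one_sub (hsm _ _), hfalse]
      rw [← ENNReal.ofReal_one, ← ENNReal.ofReal_sub _ (by linarith)]
      simp

lemma le_sprinkled {E : Type*} (ω : Config (E ⊕ E)) (e : E) (h : base ω e = true) :
    sprinkled ω e = true := by
  simp only [base] at h
  simp [sprinkled, h]

variable {E : Type*} {p p' : ℝ} {ν : Measure (Config (E ⊕ E))}

lemma IsSprinkling.measure_base (h : IsSprinkling p p' ν) (hp : p ∈ Icc (0 : ℝ) 1)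
    {μ : Measure (Config E)} (hμ : IsBernoulli p μ) {P : Config E → Prop}
    (hP : MeasurableSet {ω | P ω}) : ν {ω | P (base ω)} = μ {ω | P ω} := by
  rw [hμ.unique hp h.base_bernoulli, Measure.map_apply measurable_base hP]
  rfl

lemma IsSprinkling.measure_sprinkled (h : IsSprinkling p p' ν) (hp : p' ∈ Icc (0 : ℝ) 1)
    {μ : Measure (Config E)} (hμ : IsBernoulli p' μ) {P : Config E → Prop}
    (hP : MeasurableSet {ω | P ω}) : ν {ω | P (sprinkled ω)} = μ {ω | P ω} := by
  rw [hμ.unique hp h.sprinkled_bernoulli, Measure.map_apply measurable_sprinkled hP]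
  rfl

end Sprinkling

section Monotone

variable {G ι : Type*} [Group G] [Countable G] [Countable ι]

lemma measure_conn_mono {p p' : ℝ} (h0 : 0 ≤ p) (hpp : p ≤ p') (h1 : p < 1)
    (h1' : p' ≤ 1) {μ μ' : Measure (Config (G × ι))} (hμ : IsBernoulli p μ)
    (hμ' : IsBernoulli p' μ') (f : ι → G) (x y : G) :
    μ {ω | Conn f ω x y} ≤ μ' {ω | Conn f ω x y} := by
  obtain ⟨ν, hν⟩ := exists_isSprinkling (G × ι) h0 hpp h1 h1'
  rw [← hν.measure_base ⟨h0, h1.le⟩ hμ (measurableSet_conn f x y),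
    ← hν.measure_sprinkled ⟨h0.trans hpp, h1'⟩ hμ' (measurableSet_conn f x y)]
  exact measure_mono fun ω h => Conn.mono (le_sprinkled ω) h

lemma chi_mono {p p' : ℝ} (h0 : 0 ≤ p) (hpp : p ≤ p') (h1 : p < 1)
    (h1' : p' ≤ 1) {μ μ' : Measure (Config (G × ι))} (hμ : IsBernoulli p μ)
    (hμ' : IsBernoulli p' μ') (f : ι → G) : chi f μ ≤ chi f μ' := by
  rw [chi_eq_tsum, chi_eq_tsum]
  exact ENNReal.tsum_le_tsum fun x => measure_conn_mono h0 hpp h1 h1' hμ hμ' f 1 x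

lemma measure_conn_lt [Finite ι] {p p' : ℝ} (h0 : 0 ≤ p) (hpp : p < p') (h1' : p' ≤ 1)
    {μ μ' : Measure (Config (G × ι))} (hμ : IsBernoulli p μ)
    (hμ' : IsBernoulli p' μ') (f : ι → G) {i : ι} (hi : f i ≠ 1) :
    μ {ω | Conn f ω 1 (f i)} < μ' {ω | Conn f ω 1 (f i)} := by
  classical
  have := Fintype.ofFinite ι
  have h1 : p < 1 := by linarith
  obtain ⟨ν, hν⟩ := exists_isSprinkling (G × ι) h0 hpp.le h1 h1'
  have := hν.isProbabilityMeasure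
  rw [← hν.measure_base ⟨h0, h1.le⟩ hμ (measurableSet_conn f 1 (f i)),
    ← hν.measure_sprinkled ⟨h0.trans hpp.le, h1'⟩ hμ' (measurableSet_conn f 1 (f i))]
  let F : Finset (G × ι) := Finset.univ.image (fun j => ((1 : G), j)) ∪
    Finset.univ.image (fun j => ((f j)⁻¹, j))
  let P : Config ((G × ι) ⊕ (G × ι)) → Prop := fun ω => ∀ e ∈ F, base ω e = false
  let Q : Config ((G × ι) ⊕ (G × ι)) → Prop := fun ω => ω (.inr (1, i)) = true
  have hPm : MeasurableSet {ω | P ω} := measurable_base (measurableSet_forall_eq F fun _ => false)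
  have hpos : 0 < ν {ω | P ω ∧ Q ω} := by
    rw [measure_and_of_dependsOn hν.iIndepFun (X := range Sum.inl) (Y := range Sum.inr)
      (isCompl_range_inl_range_inr.disjoint) hPm (measurableSet_open _)
      (fun x y h => by simp [P, base, h]) (fun x y h => by simp [h])]
    refine ENNReal.mul_pos ?_ ?_
    · have h := hν.base_bernoulli F fun _ => false
      rw [Measure.map_apply measurable_base (measurableSet_forall_eq F _)] at h
      refine ne_of_eq_of_ne h ?_
      simp only [Bool.false_eq_true, if_false, Finset.prod_const]
      exact pow_ne_zero _ (by simpa using h1)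
    · rw [hν.inr_open]
      simpa using div_pos (by linarith) (by linarith)
  have hdisj : Disjoint {ω | Conn f (base ω) 1 (f i)} {ω | P ω ∧ Q ω} := by
    rw [Set.disjoint_left]
    rintro ω hc ⟨hP, -⟩
    rcases Relation.ReflTransGen.cases_head hc with h | ⟨c, ⟨j, hj | hj⟩, -⟩
    · exact hi h.symm
    · have := hP (1, j) (by simp [F])
      simp [this] at hj
    · have hc : c = (f j)⁻¹ := eq_inv_of_mul_eq_one_left hj.2.symm
      have := hP (c, j) (by simp [F, hc])
      simp [this] at hj
  calc ν {ω | Conn f (base ω) 1 (f i)}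
      < ν {ω | Conn f (base ω) 1 (f i)} + ν {ω | P ω ∧ Q ω} :=
        ENNReal.lt_add_right (measure_ne_top _ _) hpos.ne'
    _ = ν ({ω | Conn f (base ω) 1 (f i)} ∪ {ω | P ω ∧ Q ω}) :=
        (measure_union hdisj (hPm.inter (measurableSet_open _))).symm
    _ ≤ ν {ω | Conn f (sprinkled ω) 1 (f i)} := by
        refine measure_mono ?_
        rintro ω (h | h)
        · exact Conn.mono (le_sprinkled ω) h
        · refine Relation.ReflTransGen.single ⟨i, .inl ⟨?_, by simp⟩⟩
          have : ω (.inr (1, i)) = true := h.2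
          simp [sprinkled, this]

lemma chi_lt [Finite ι] {p p' : ℝ} (h0 : 0 ≤ p) (hpp : p < p') (h1' : p' ≤ 1)
    {μ μ' : Measure (Config (G × ι))} (hμ : IsBernoulli p μ)
    (hμ' : IsBernoulli p' μ') (f : ι → G) {i : ι} (hi : f i ≠ 1) (hfin : chi f μ ≠ ∞) :
    chi f μ < chi f μ' := by
  rw [chi_eq_tsum] at hfin ⊢
  rw [chi_eq_tsum]
  exact ENNReal.tsum_lt_tsum hfin
    (fun x => measure_conn_mono h0 hpp.le (by linarith) h1' hμ hμ' f 1 x)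
    (measure_conn_lt h0 hpp h1' hμ hμ' f hi)

end Monotone

section Exploration

variable {G ι : Type*} [Group G]

/-- The `k`-th neighbour of the vertex `a`. -/
def nbr (f : ι → G) (a : G) (k : ι × Bool) : G := a * (if k.2 then f k.1 else (f k.1)⁻¹)

/-- The edge leading from the vertex `a` to its `k`-th neighbour. -/
def nbrEdge (f : ι → G) (a : G) (k : ι × Bool) : G × ι :=
  (if k.2 then a else a * (f k.1)⁻¹, k.1)

lemma step_iff_exists_nbr {f : ι → G} {ω : Config (G × ι)} {a b : G} :
    Step f ω a b ↔ ∃ k, ω (nbrEdge f a k) = true ∧ b = nbr f a k := by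
  constructor
  · rintro ⟨i, ⟨h, rfl⟩ | ⟨h, rfl⟩⟩
    · exact ⟨(i, true), by simpa [nbrEdge] using h, by simp [nbr]⟩
    · exact ⟨(i, false), by simpa [nbrEdge] using h, by simp [nbr]⟩
  · rintro ⟨⟨i, b⟩, h, rfl⟩
    cases b
    · exact ⟨i, .inr ⟨by simpa [nbrEdge, nbr] using h, by simp [nbr]⟩⟩
    · exact ⟨i, .inl ⟨by simpa [nbrEdge] using h, by simp [nbr]⟩⟩

/-- The edges with at least one endpoint in `A`. -/
def touching (f : ι → G) (A : Set G) : Set (G × ι) := {e | e.1 ∈ A ∨ e.1 * f e.2 ∈ A}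

/-- The edges with both endpoints in `A`. -/
def inside (f : ι → G) (A : Set G) : Set (G × ι) := {e | e.1 ∈ A ∧ e.1 * f e.2 ∈ A}

lemma nbrEdge_mem_touching {f : ι → G} {A : Set G} {a : G} (ha : a ∈ A) (k : ι × Bool) :
    nbrEdge f a k ∈ touching f A := by
  rcases k with ⟨i, _ | _⟩ <;> simp [nbrEdge, touching, ha]

lemma Step.congr_of_touching {f : ι → G} {A : Set G} {ω ω' : Config (G × ι)} {a b : G}
    (h : ∀ e ∈ touching f A, ω e = ω' e) (ha : a ∈ A) (hs : Step f ω a b) : Step f ω' a b := by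
  obtain ⟨k, hk, rfl⟩ := step_iff_exists_nbr.1 hs
  exact step_iff_exists_nbr.2 ⟨k, by rw [← h _ (nbrEdge_mem_touching ha k), hk], rfl⟩

lemma dependsOn_connIn (f : ι → G) (V : Set G) (x y : G) :
    DependsOn (fun ω : Config (G × ι) => ConnIn f V ω x y) (inside f V) := by
  have key : ∀ ω ω' : Config (G × ι), (∀ e ∈ inside f V, ω e = ω' e) → ConnIn f V ω x y →
      ConnIn f V ω' x y := by
    intro ω ω' h hc
    refine Relation.ReflTransGen.mono (fun a b hab => ⟨?_, hab.2⟩) _ _ hc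
    obtain ⟨⟨i, ⟨ho, rfl⟩ | ⟨ho, rfl⟩⟩, ha, hb⟩ := hab
    · exact ⟨i, .inl ⟨by rw [← h _ ⟨ha, hb⟩, ho], rfl⟩⟩
    · exact ⟨i, .inr ⟨by rw [← h _ ⟨hb, ha⟩, ho], rfl⟩⟩
  exact fun ω ω' h => propext ⟨key ω ω' h, key ω' ω fun e he => (h e he).symm⟩

/-- The cluster of `x` inside `V` is `A`. -/
def ClusterEq (f : ι → G) (V : Set G) (x : G) (A : Set G) (ω : Config (G × ι)) : Prop :=
  ∀ z, ConnIn f V ω x z ↔ z ∈ A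

lemma dependsOn_clusterEq (f : ι → G) (V : Set G) (x : G) (A : Set G) :
    DependsOn (ClusterEq f V x A) (touching f A) := by
  have key : ∀ ω ω' : Config (G × ι), (∀ e ∈ touching f A, ω e = ω' e) → ClusterEq f V x A ω →
      ClusterEq f V x A ω' := by
    intro ω ω' h hc z
    have hfw : ConnIn f V ω' x z → z ∈ A := by
      intro hz
      induction hz with
      | refl => exact (hc x).1 .refl
      | tail _ hs ih =>
        exact (hc _).1 (((hc _).2 ih).tail
          ⟨hs.1.congr_of_touching (fun e he => (h e he).symm) ih, hs.2⟩)
    refine ⟨hfw, fun hz => ?_⟩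
    have hz' : ConnIn f V ω x z := (hc z).2 hz
    clear hfw hz
    induction hz' with
    | refl => exact .refl
    | tail hb hs ih => exact ih.tail ⟨hs.1.congr_of_touching h ((hc _).1 hb), hs.2⟩
  exact fun ω ω' h => propext ⟨key ω ω' h, key ω' ω fun e he => (h e he).symm⟩

lemma ConnIn.exists_last_exit {f : ι → G} {V : Set G} {ω : Config ((G × ι) ⊕ (G × ι))} {x y : G}
    {A : Set G} (hA : ClusterEq f V x A (base ω)) (h : ConnIn f V (sprinkled ω) x y) :
    y ∈ A ∨ ∃ a ∈ A, ∃ k, nbr f a k ∈ V ∧ ω (.inr (nbrEdge f a k)) = true ∧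
      ConnIn f (V \ A) (sprinkled ω) (nbr f a k) y := by
  induction h with
  | refl => exact .inl ((hA x).1 .refl)
  | @tail b c _ hs ih =>
    by_cases hc : c ∈ A
    · exact .inl hc
    by_cases hb : b ∈ A
    · obtain ⟨k, hk, rfl⟩ := step_iff_exists_nbr.1 hs.1
      refine .inr ⟨b, hb, k, hs.2.2, ?_, .refl⟩
      cases hbase : base ω (nbrEdge f b k) with
      | true =>
        exact absurd ((hA _).1 (((hA b).2 hb).tail
          ⟨step_iff_exists_nbr.2 ⟨k, hbase, rfl⟩, hs.2⟩)) hc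
      | false =>
        simp only [base] at hbase
        simpa [sprinkled, hbase] using hk
    · obtain ⟨a, ha, k, hV, ho, hcn⟩ := ih.resolve_left hb
      exact .inr ⟨a, ha, k, hV, ho, hcn.tail ⟨hs.1, ⟨hs.2.1, hb⟩, ⟨hs.2.2, hc⟩⟩⟩

variable [Countable G] [Countable ι]

lemma measurableSet_clusterEq (f : ι → G) (V : Set G) (x : G) (A : Set G) :
    MeasurableSet {ω | ClusterEq f V x A ω} := by
  have : {ω | ClusterEq f V x A ω} = ⋂ z, {ω | ConnIn f V ω x z ↔ z ∈ A} := by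
    ext ω; simp [ClusterEq]
  rw [this]
  refine MeasurableSet.iInter fun z => ?_
  by_cases hz : z ∈ A
  · simp only [hz, iff_true]
    exact measurableSet_connIn f V x z
  · simp only [hz, iff_false]
    exact (measurableSet_connIn f V x z).compl

variable {p p' : ℝ} {ν : Measure (Config ((G × ι) ⊕ (G × ι)))}

lemma IsSprinkling.measure_exit (hν : IsSprinkling p p' ν) (f : ι → G) (V : Set G) (x y z : G)
    {A : Set G} {a : G} (ha : a ∈ A) (k : ι × Bool) :
    ν {ω | ClusterEq f V x A (base ω) ∧ ω (.inr (nbrEdge f a k)) = true ∧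
      ConnIn f (V \ A) (sprinkled ω) z y} =
    ν {ω | ClusterEq f V x A (base ω)} * (ENNReal.ofReal ((p' - p) / (1 - p)) *
      ν {ω | ConnIn f (V \ A) (sprinkled ω) z y}) := by
  have hdisj : Disjoint (touching f A) (inside f (V \ A)) := by
    rw [Set.disjoint_left]
    rintro e (h | h) ⟨h1, h2⟩
    · exact h1.2 h
    · exact h2.2 h
  have hm1 : MeasurableSet {ω : Config ((G × ι) ⊕ (G × ι)) | ClusterEq f V x A (base ω)} :=
    measurable_base (measurableSet_clusterEq f V x A)
  have hm3 : MeasurableSet {ω : Config ((G × ι) ⊕ (G × ι)) |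
      ConnIn f (V \ A) (sprinkled ω) z y} :=
    measurable_sprinkled (measurableSet_connIn f (V \ A) z y)
  have hd1 : DependsOn (fun ω : Config ((G × ι) ⊕ (G × ι)) => ClusterEq f V x A (base ω))
      (Sum.inl '' touching f A) := fun ω ω' h =>
    dependsOn_clusterEq f V x A fun e he => h _ (mem_image_of_mem _ he)
  have hd2 : DependsOn (fun ω : Config ((G × ι) ⊕ (G × ι)) => ω (.inr (nbrEdge f a k)) = true)
      {.inr (nbrEdge f a k)} := fun ω ω' h => by simp [h (.inr (nbrEdge f a k)) rfl]
  have hd3 : DependsOn (fun ω : Config ((G × ι) ⊕ (G × ι)) => ConnIn f (V \ A) (sprinkled ω) z y)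
      (Sum.inl '' inside f (V \ A) ∪ Sum.inr '' inside f (V \ A)) := fun ω ω' h =>
    dependsOn_connIn f (V \ A) z y fun e he => by
      simp [sprinkled, h (.inl e) (.inl (mem_image_of_mem _ he)),
        h (.inr e) (.inr (mem_image_of_mem _ he))]
  have hm23 : MeasurableSet {ω : Config ((G × ι) ⊕ (G × ι)) |
      ω (.inr (nbrEdge f a k)) = true ∧ ConnIn f (V \ A) (sprinkled ω) z y} :=
    (measurableSet_open _).inter hm3
  rw [measure_and_of_dependsOn hν.iIndepFun (Y := {.inr (nbrEdge f a k)} ∪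
      (Sum.inl '' inside f (V \ A) ∪ Sum.inr '' inside f (V \ A))) ?_ hm1 hm23 hd1,
    measure_and_of_dependsOn hν.iIndepFun ?_ (measurableSet_open _) hm3 hd2 hd3, hν.inr_open]
  · rw [Set.disjoint_left]
    rintro _ rfl (⟨e, -, he⟩ | ⟨e, he, hee⟩)
    · simp at he
    · obtain rfl := Sum.inr_injective hee
      exact hdisj.le_bot ⟨nbrEdge_mem_touching ha k, he⟩
  · intro ω ω' h
    have h2 := hd2 (fun e he => h e (.inl he))
    have h3 := hd3 (fun e he => h e (.inr he))
    simp only at h2 h3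
    simp only [h2, h3]
  · rw [Set.disjoint_left]
    rintro _ ⟨e, he, rfl⟩ (h | ⟨e', he', h⟩ | ⟨e', he', h⟩)
    · simp at h
    · obtain rfl := Sum.inl_injective h
      exact hdisj.le_bot ⟨he, he'⟩
    · simp at h

end Exploration

section Lipschitz

variable {G ι : Type*} [Group G] [Countable G] [Fintype ι]
variable {p p' : ℝ} {ν : Measure (Config ((G × ι) ⊕ (G × ι)))}

lemma sum_measure_clusterEq_le (hν : IsSprinkling p p' ν) (hp : p ∈ Icc (0 : ℝ) 1)
    {μ : Measure (Config (G × ι))} (hμ : IsBernoulli p μ) (f : ι → G) (V : Finset G) (x : G) :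
    ∑ A ∈ V.powerset, ν {ω | ClusterEq f V x A (base ω)} * A.card ≤ chi f μ := by
  classical
  have hmeas : ∀ A : Finset G, MeasurableSet {ω : Config ((G × ι) ⊕ (G × ι)) |
      ClusterEq f V x A (base ω)} := fun A => measurable_base (measurableSet_clusterEq f V x A)
  calc ∑ A ∈ V.powerset, ν {ω | ClusterEq f V x A (base ω)} * A.card
      = ∑ A ∈ V.powerset, ∑ y ∈ V,
          if y ∈ A then ν {ω | ClusterEq f V x A (base ω)} else 0 := by
        refine Finset.sum_congr rfl fun A hA => ?_
        rw [← Finset.sum_filter, Finset.filter_mem_eq_inter,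
          Finset.inter_eq_right.2 (Finset.mem_powerset.1 hA), Finset.sum_const, nsmul_eq_mul,
          mul_comm]
    _ = ∑ y ∈ V, ν (⋃ A ∈ V.powerset.filter (y ∈ ·), {ω | ClusterEq f V x A (base ω)}) := by
        rw [Finset.sum_comm]
        refine Finset.sum_congr rfl fun y _ => ?_
        rw [← Finset.sum_filter, measure_biUnion_finset _ fun A _ => hmeas A]
        intro A _ B _ hAB
        rw [Function.onFun, Set.disjoint_left]
        intro ω h1 h2
        exact hAB (Finset.ext fun z => by
          rw [← Finset.mem_coe, ← Finset.mem_coe, ← h1 z, ← h2 z])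
    _ ≤ ∑ y ∈ V, μ {ω | Conn f ω x y} := by
        refine Finset.sum_le_sum fun y _ => ?_
        rw [← hν.measure_base hp hμ (measurableSet_conn f x y)]
        refine measure_mono (iUnion₂_subset fun A hA ω hω => ?_)
        exact ((hω y).2 (Finset.mem_filter.1 hA).2).conn
    _ ≤ chi f μ := sum_measure_conn_le_chi hp hμ f x V

lemma measure_connIn_sprinkled_le (hν : IsSprinkling p p' ν) (f : ι → G) [DecidableEq G]
    (V : Finset G) {x : G} (hx : x ∈ V) (y : G) :
    ν {ω | ConnIn f V (sprinkled ω) x y} ≤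
      ∑ A ∈ V.powerset, ((if y ∈ A then ν {ω | ClusterEq f V x A (base ω)} else 0) +
        ∑ a ∈ A, ∑ k : ι × Bool, ν {ω | ClusterEq f V x A (base ω)} *
          (ENNReal.ofReal ((p' - p) / (1 - p)) *
            if nbr f a k ∈ V then ν {ω | ConnIn f V (sprinkled ω) (nbr f a k) y} else 0)) := by
  classical
  let D : Finset G → Set (Config ((G × ι) ⊕ (G × ι))) := fun A =>
    {ω | y ∈ A ∧ ClusterEq f V x A (base ω)} ∪ ⋃ a ∈ A, ⋃ k ∈ (Finset.univ : Finset (ι × Bool)),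
      {ω | nbr f a k ∈ V ∧ ClusterEq f V x A (base ω) ∧ ω (.inr (nbrEdge f a k)) = true ∧
        ConnIn f (V \ A : Set G) (sprinkled ω) (nbr f a k) y}
  have hcover : {ω | ConnIn f V (sprinkled ω) x y} ⊆ ⋃ A ∈ V.powerset, D A := by
    intro ω hω
    let A := V.filter fun z => ConnIn f V (base ω) x z
    have hA : ClusterEq f V x A (base ω) := fun z => by
      simp only [A, Finset.coe_filter, mem_ofPred_eq]
      exact ⟨fun h => ⟨h.mem hx, h⟩, fun h => h.2⟩
    refine mem_iUnion₂.2 ⟨A, Finset.mem_powerset.2 (Finset.filter_subset _ _), ?_⟩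
    rcases ConnIn.exists_last_exit hA hω with h | ⟨a, ha, k, h1, h2, h3⟩
    · exact .inl ⟨h, hA⟩
    · exact .inr (mem_iUnion₂.2 ⟨a, ha, mem_iUnion₂.2 ⟨k, Finset.mem_univ k, h1, hA, h2, h3⟩⟩)
  refine (measure_mono hcover).trans ((measure_biUnion_finset_le _ _).trans
    (Finset.sum_le_sum fun A _ => (measure_union_le _ _).trans (add_le_add ?_ ?_)))
  · by_cases hy : y ∈ A <;> simp [hy]
  · refine (measure_biUnion_finset_le _ _).trans (Finset.sum_le_sum fun a ha =>
      (measure_biUnion_finset_le _ _).trans (Finset.sum_le_sum fun k _ => ?_))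
    by_cases hk : nbr f a k ∈ V
    · simp only [hk, true_and, if_true]
      rw [hν.measure_exit f V x y (nbr f a k) (Finset.mem_coe.2 ha) k]
      gcongr
      exact ConnIn.mono sdiff_subset
    · simp [hk]

lemma sum_measure_connIn_sprinkled_le (hν : IsSprinkling p p' ν) (hp : p ∈ Icc (0 : ℝ) 1)
    {μ : Measure (Config (G × ι))} (hμ : IsBernoulli p μ) (f : ι → G) (V : Finset G) {M : ℝ≥0∞}
    (hM : ∀ z ∈ V, ∑ y ∈ V, ν {ω | ConnIn f V (sprinkled ω) z y} ≤ M) {x : G} (hx : x ∈ V) :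
    ∑ y ∈ V, ν {ω | ConnIn f V (sprinkled ω) x y} ≤
      chi f μ * (1 + Fintype.card (ι × Bool) * (ENNReal.ofReal ((p' - p) / (1 - p)) * M)) := by
  classical
  set q := ENNReal.ofReal ((p' - p) / (1 - p))
  calc ∑ y ∈ V, ν {ω | ConnIn f V (sprinkled ω) x y}
      ≤ ∑ A ∈ V.powerset, (∑ y ∈ V, (if y ∈ A then ν {ω | ClusterEq f V x A (base ω)} else 0) +
        ∑ a ∈ A, ∑ k : ι × Bool, ∑ y ∈ V, ν {ω | ClusterEq f V x A (base ω)} *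
          (q * if nbr f a k ∈ V then ν {ω | ConnIn f V (sprinkled ω) (nbr f a k) y} else 0)) := by
        refine (Finset.sum_le_sum fun y _ =>
          measure_connIn_sprinkled_le hν f V hx y).trans_eq ?_
        rw [Finset.sum_comm]
        refine Finset.sum_congr rfl fun A _ => ?_
        rw [Finset.sum_add_distrib, Finset.sum_comm (s := V) (t := A)]
        simp only [Finset.sum_comm (s := V) (t := Finset.univ)]
        rfl
    _ ≤ ∑ A ∈ V.powerset, (ν {ω | ClusterEq f V x A (base ω)} * A.card +
        ∑ a ∈ A, ∑ k : ι × Bool, ν {ω | ClusterEq f V x A (base ω)} * (q * M)) := by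
        refine Finset.sum_le_sum fun A hA => add_le_add (le_of_eq ?_)
          (Finset.sum_le_sum fun a _ => Finset.sum_le_sum fun k _ => ?_)
        · rw [← Finset.sum_filter, Finset.filter_mem_eq_inter,
            Finset.inter_eq_right.2 (Finset.mem_powerset.1 hA), Finset.sum_const, nsmul_eq_mul,
            mul_comm]
        · rw [← Finset.mul_sum, ← Finset.mul_sum]
          gcongr
          split_ifs with h
          · exact hM _ h
          · simp
    _ = (∑ A ∈ V.powerset, ν {ω | ClusterEq f V x A (base ω)} * A.card) *
        (1 + Fintype.card (ι × Bool) * (q * M)) := by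
        rw [Finset.sum_mul]
        refine Finset.sum_congr rfl fun A _ => ?_
        simp only [Finset.sum_const, nsmul_eq_mul, Finset.card_univ]
        ring
    _ ≤ _ := by
        gcongr
        exact sum_measure_clusterEq_le hν hp hμ f V x

/-- A form of the Aizenman–Newman differential inequality. -/
lemma chi_inv_le_add (h0 : 0 ≤ p) (hpp : p ≤ p') (h1 : p < 1) (h1' : p' ≤ 1)
    {μ μ' : Measure (Config (G × ι))} (hμ : IsBernoulli p μ) (hμ' : IsBernoulli p' μ')
    (f : ι → G) :
    (chi f μ)⁻¹ ≤ (chi f μ')⁻¹ +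
      Fintype.card (ι × Bool) * ENNReal.ofReal ((p' - p) / (1 - p)) := by
  obtain ⟨ν, hν⟩ := exists_isSprinkling (G × ι) h0 hpp h1 h1'
  have := hν.isProbabilityMeasure
  have := hμ.isProbabilityMeasure
  set q := ENNReal.ofReal ((p' - p) / (1 - p)) with hq
  set D : ℝ≥0∞ := Fintype.card (ι × Bool) * q with hD
  have hDtop : D ≠ ∞ := by simp [hD, hq, ENNReal.mul_eq_top]
  by_cases hDb : (chi f μ)⁻¹ ≤ D
  · exact hDb.trans le_add_self
  push Not at hDb
  have hχ0 : chi f μ ≠ 0 := (zero_lt_one.trans_le (one_le_chi f μ)).ne'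
  have hχtop : chi f μ ≠ ∞ := by
    intro h
    simp [h] at hDb
  have hfinite : ∀ V : Finset G, ∀ x ∈ V,
      ∑ y ∈ V, ν {ω | ConnIn f V (sprinkled ω) x y} ≤ ((chi f μ)⁻¹ - D)⁻¹ := by
    intro V x hx
    set M := V.sup fun x => ∑ y ∈ V, ν {ω | ConnIn f V (sprinkled ω) x y} with hMdef
    have hM : ∀ z ∈ V, ∑ y ∈ V, ν {ω | ConnIn f V (sprinkled ω) z y} ≤ M := fun z hz =>
      Finset.le_sup (f := fun x => ∑ y ∈ V, ν {ω | ConnIn f V (sprinkled ω) x y}) hz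
    refine (hM x hx).trans ?_
    have hMtop : M ≠ ∞ := by
      refine ((Finset.sup_lt_iff (by simp)).2 fun z _ => ?_).ne
      exact ENNReal.sum_lt_top.2 fun y _ => measure_lt_top _ _
    have hrec : M ≤ chi f μ * (1 + D * M) := by
      refine Finset.sup_le fun z hz => ?_
      have := sum_measure_connIn_sprinkled_le hν ⟨h0, h1.le⟩ hμ f V hM hz
      rwa [← mul_assoc] at this
    rw [ENNReal.le_inv_iff_mul_le]
    rw [ENNReal.mul_sub (fun _ _ => hMtop)]
    refine tsub_le_iff_right.2 ?_
    calc M * (chi f μ)⁻¹ ≤ chi f μ * (1 + D * M) * (chi f μ)⁻¹ := by gcongr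
      _ = (1 + D * M) * (chi f μ * (chi f μ)⁻¹) := by ring
      _ = 1 + M * D := by rw [ENNReal.mul_inv_cancel hχ0 hχtop]; ring
  have hχ' : chi f μ' ≤ ((chi f μ)⁻¹ - D)⁻¹ := by
    classical
    rw [chi_eq_tsum, ENNReal.tsum_eq_iSup_sum]
    refine iSup_le fun T => ?_
    have hlim : Tendsto (fun V : Finset G => ∑ y ∈ T, ν {ω | ConnIn f V (sprinkled ω) 1 y}) atTop
        (𝓝 (∑ y ∈ T, μ' {ω | Conn f ω 1 y})) := by
      refine tendsto_finsetSum _ fun y _ => ?_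
      have hU : ⋃ V : Finset G, {ω : Config ((G × ι) ⊕ (G × ι)) | ConnIn f V (sprinkled ω) 1 y} =
          {ω | Conn f (sprinkled ω) 1 y} := by
        ext ω
        simp only [mem_iUnion, mem_ofPred_eq]
        exact ⟨fun ⟨V, h⟩ => h.conn, fun h => h.exists_connIn⟩
      rw [← hν.measure_sprinkled ⟨h0.trans hpp, h1'⟩ hμ' (measurableSet_conn f 1 y), ← hU]
      exact tendsto_measure_iUnion_atTop fun V W hVW ω h => ConnIn.mono (by simpa using hVW) h
    refine le_of_tendsto hlim ?_
    filter_upwards [eventually_ge_atTop (insert 1 T)] with V hV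
    refine (Finset.sum_le_sum_of_subset ((Finset.subset_insert 1 T).trans hV)).trans
      (hfinite V 1 (hV (Finset.mem_insert_self 1 T)))
  have := ENNReal.inv_le_inv.2 hχ'
  rw [inv_inv] at this
  exact tsub_le_iff_right.1 this

end Lipschitz

section InverseSusceptibility

variable {G ι : Type*} [Group G]

/-- The inverse `1/χ` of the expected cluster size, as a real number. -/
noncomputable def invChi (f : ι → G) (μ : Measure (Config (G × ι))) : ℝ := ((chi f μ)⁻¹).toReal

variable [Countable G] [Fintype ι] {f : ι → G} {μ : ℝ → Measure (Config (G × ι))}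

lemma chi_inv_le_one {p : ℝ} (hμ : ∀ p ∈ Icc (0 : ℝ) 1, IsBernoulli p (μ p))
    (hp : p ∈ Icc (0 : ℝ) 1) : (chi f (μ p))⁻¹ ≤ 1 := by
  have := (hμ p hp).isProbabilityMeasure
  exact ENNReal.inv_le_one.2 (one_le_chi f (μ p))

lemma chi_inv_ne_top {p : ℝ} (hμ : ∀ p ∈ Icc (0 : ℝ) 1, IsBernoulli p (μ p))
    (hp : p ∈ Icc (0 : ℝ) 1) : (chi f (μ p))⁻¹ ≠ ∞ :=
  ((chi_inv_le_one hμ hp).trans_lt ENNReal.one_lt_top).ne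

lemma antitoneOn_invChi (hμ : ∀ p ∈ Icc (0 : ℝ) 1, IsBernoulli p (μ p)) :
    AntitoneOn (fun p => invChi f (μ p)) (Icc 0 1) := by
  intro p hp p' hp' h
  rcases h.eq_or_lt with rfl | h
  · exact le_rfl
  · exact ENNReal.toReal_mono (chi_inv_ne_top hμ hp) (ENNReal.inv_le_inv.2
      (chi_mono hp.1 h.le (h.trans_le hp'.2) hp'.2 (hμ p hp) (hμ p' hp') f))

lemma invChi_lt (hμ : ∀ p ∈ Icc (0 : ℝ) 1, IsBernoulli p (μ p)) {i : ι} (hi : f i ≠ 1) {p p' : ℝ}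
    (hp : p ∈ Icc (0 : ℝ) 1) (hp' : p' ∈ Icc (0 : ℝ) 1) (h : p < p') (h0 : 0 < invChi f (μ p)) :
    invChi f (μ p') < invChi f (μ p) := by
  have hfin : chi f (μ p) ≠ ∞ := by
    intro h
    simp [invChi, h] at h0
  exact (ENNReal.toReal_lt_toReal (chi_inv_ne_top hμ hp') (chi_inv_ne_top hμ hp)).2
    (ENNReal.inv_lt_inv.2 (chi_lt hp.1 h hp'.2 (hμ p hp) (hμ p' hp') f hi hfin))

lemma invChi_le_add (hμ : ∀ p ∈ Icc (0 : ℝ) 1, IsBernoulli p (μ p)) {p p' : ℝ}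
    (hp : p ∈ Icc (0 : ℝ) 1) (hp' : p' ∈ Icc (0 : ℝ) 1) (h : p ≤ p') (h1 : p < 1) :
    invChi f (μ p) ≤ invChi f (μ p') + Fintype.card (ι × Bool) * ((p' - p) / (1 - p)) := by
  have key := chi_inv_le_add hp.1 h h1 hp'.2 (hμ p hp) (hμ p' hp') f
  have hq : (Fintype.card (ι × Bool) : ℝ≥0∞) * ENNReal.ofReal ((p' - p) / (1 - p)) ≠ ∞ :=
    ENNReal.mul_ne_top (ENNReal.natCast_ne_top _) ENNReal.ofReal_ne_top
  have := ENNReal.toReal_mono (ENNReal.add_ne_top.2 ⟨chi_inv_ne_top hμ hp', hq⟩) key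
  rwa [ENNReal.toReal_add (chi_inv_ne_top hμ hp') hq, ENNReal.toReal_mul, ENNReal.toReal_natCast,
    ENNReal.toReal_ofReal (div_nonneg (by linarith) (by linarith))] at this

lemma tendsto_chi_one (hf : Subgroup.closure (range f) = ⊤)
    (hμ : ∀ p ∈ Icc (0 : ℝ) 1, IsBernoulli p (μ p)) :
    Tendsto (fun p => chi f (μ p)) (𝓝[Icc 0 1] 1) (𝓝 (chi f (μ 1))) := by
  have h1 : (1 : ℝ) ∈ Icc (0 : ℝ) 1 := by simp
  have := (hμ 1 h1).isProbabilityMeasure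
  refine tendsto_order.2 ⟨fun c hc => ?_, fun c hc => ?_⟩
  · rw [chi_eq_tsum, ENNReal.tsum_eq_iSup_sum] at hc
    obtain ⟨V, hV⟩ := lt_iSup_iff.1 hc
    choose n hn using exists_pow_le_measure_conn f hf
    have hlim : Tendsto (fun p : ℝ => ∑ x ∈ V, ENNReal.ofReal p ^ n x) (𝓝[Icc 0 1] 1)
        (𝓝 (∑ x ∈ V, ENNReal.ofReal 1 ^ n x)) := by
      refine tendsto_finsetSum _ fun x _ => Tendsto.mono_left ?_ nhdsWithin_le_nhds
      exact ((ENNReal.continuous_pow (n x)).comp ENNReal.continuous_ofReal).tendsto 1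
    have hlt : c < ∑ x ∈ V, ENNReal.ofReal 1 ^ n x := by
      refine hV.trans_le (Finset.sum_le_sum fun x _ => ?_)
      simpa using prob_le_one
    filter_upwards [hlim.eventually_const_lt hlt, self_mem_nhdsWithin] with p hp hpI
    refine hp.trans_le ((Finset.sum_le_sum fun x _ => hn x p _ (hμ p hpI)).trans ?_)
    rw [chi_eq_tsum]
    exact ENNReal.sum_le_tsum V
  · filter_upwards [self_mem_nhdsWithin] with p hp
    refine lt_of_le_of_lt ?_ hc
    rcases hp.2.eq_or_lt with rfl | h
    · exact le_rfl
    · exact chi_mono hp.1 h.le h le_rfl (hμ p hp) (hμ 1 h1) f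

lemma continuousOn_invChi (hf : Subgroup.closure (range f) = ⊤)
    (hμ : ∀ p ∈ Icc (0 : ℝ) 1, IsBernoulli p (μ p)) :
    ContinuousOn (fun p => invChi f (μ p)) (Icc 0 1) := by
  intro x hx
  rcases hx.2.eq_or_lt with rfl | hx1
  · exact (ENNReal.tendsto_toReal (chi_inv_ne_top hμ hx)).comp
      ((continuous_inv.tendsto _).comp (tendsto_chi_one hf hμ))
  set D : ℝ := ((Fintype.card (ι × Bool) : ℕ) : ℝ)
  have hbound : ∀ y ∈ Icc (0 : ℝ) 1,
      |invChi f (μ y) - invChi f (μ x)| ≤ D * (|y - x| / (1 - x)) := by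
    intro y hy
    have h1x : 0 < 1 - x := by linarith
    rcases le_total x y with h | h
    · have h2 := invChi_le_add (f := f) hμ hx hy h hx1
      have h3 := antitoneOn_invChi (f := f) hμ hx hy h
      simp only at h3
      rw [abs_of_nonpos (by linarith), abs_of_nonneg (by linarith)]
      linarith
    · have h2 := invChi_le_add (f := f) hμ hy hx h (by linarith)
      have h3 := antitoneOn_invChi (f := f) hμ hy hx h
      simp only at h3
      rw [abs_of_nonneg (by linarith), abs_of_nonpos (by linarith), neg_sub]
      have : (x - y) / (1 - y) ≤ (x - y) / (1 - x) :=
        div_le_div_of_nonneg_left (by linarith) h1x (by linarith)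
      have : D * ((x - y) / (1 - y)) ≤ D * ((x - y) / (1 - x)) := by gcongr
      linarith
  refine tendsto_iff_dist_tendsto_zero.2 (squeeze_zero' (.of_forall fun _ => dist_nonneg)
    (g := fun y => D * (|y - x| / (1 - x))) ?_ ?_)
  · filter_upwards [self_mem_nhdsWithin] with y hy
    exact hbound y hy
  · have : Continuous fun y => D * (|y - x| / (1 - x)) := by fun_prop
    have h := this.tendsto x
    simp only [sub_self, abs_zero, zero_div, mul_zero] at h
    exact h.mono_left nhdsWithin_le_nhds

lemma invChi_zero (hμ : ∀ p ∈ Icc (0 : ℝ) 1, IsBernoulli p (μ p)) : invChi f (μ 0) = 1 := by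
  have h0 : (0 : ℝ) ∈ Icc (0 : ℝ) 1 := by simp
  have := (hμ 0 h0).isProbabilityMeasure
  have hedge : ∀ e, μ 0 {ω | ω e = true} = 0 := fun e => by
    simpa using hμ 0 h0 {e} fun _ => true
  have hle : chi f (μ 0) ≤ 1 := by
    classical
    rw [chi_eq_tsum, tsum_eq_single 1 fun x hx => ?_]
    · exact prob_le_one
    · refine measure_mono_null (t := ⋃ e, {ω | ω e = true}) (fun ω h => ?_)
        (measure_iUnion_null hedge)
      rcases Relation.ReflTransGen.cases_head h with h | ⟨c, ⟨j, hj | hj⟩, -⟩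
      · exact absurd h.symm hx
      · exact mem_iUnion.2 ⟨_, hj.1⟩
      · exact mem_iUnion.2 ⟨_, hj.1⟩
  rw [invChi, le_antisymm hle (one_le_chi f _)]
  simp

lemma invChi_one_le [Nontrivial G] (hf : Subgroup.closure (range f) = ⊤)
    (hμ : ∀ p ∈ Icc (0 : ℝ) 1, IsBernoulli p (μ p)) : invChi f (μ 1) ≤ 1 / 2 := by
  classical
  obtain ⟨g, hg⟩ := exists_ne (1 : G)
  choose n hn using exists_pow_le_measure_conn f hf
  have h1 : (1 : ℝ) ∈ Icc (0 : ℝ) 1 := by simp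
  have h2 : (2 : ℝ≥0∞) ≤ chi f (μ 1) := by
    rw [chi_eq_tsum]
    refine le_trans ?_ (ENNReal.sum_le_tsum {1, g})
    rw [Finset.sum_pair hg.symm, ← one_add_one_eq_two]
    exact add_le_add (by simpa using hn 1 1 _ (hμ 1 h1)) (by simpa using hn g 1 _ (hμ 1 h1))
  have := ENNReal.toReal_mono (by simp) (ENNReal.inv_le_inv.2 h2)
  simpa [invChi] using this

lemma exists_ne_one_of_closure_range {ι G : Type*} [Group G] [Nontrivial G] {f : ι → G}
    (hf : Subgroup.closure (range f) = ⊤) : ∃ i, f i ≠ 1 := by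
  by_contra! h
  have : Subgroup.closure (range f) = ⊥ := by
    rw [Subgroup.closure_eq_bot_iff]
    rintro _ ⟨i, rfl⟩
    exact h i
  exact bot_ne_top (this.symm.trans hf)

end InverseSusceptibility

section Root

variable {n : ℕ} {G ι : Fin n → Type*} [∀ i, Group (G i)]
  [∀ i, Countable (G i)] [∀ i, Fintype (ι i)] {f : ∀ i, ι i → G i}
  {μ : ∀ i, ℝ → Measure (Config (G i × ι i))}

lemma sum_chi_inv_eq_iff (hn : 1 ≤ n) (hμ : ∀ i, ∀ p ∈ Icc (0 : ℝ) 1, IsBernoulli p (μ i p))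
    {p : ℝ} (hp : p ∈ Icc (0 : ℝ) 1) :
    ∑ i, (chi (f i) (μ i p))⁻¹ = (n : ℝ≥0∞) - 1 ↔ ∑ i, invChi (f i) (μ i p) = n - 1 := by
  rw [← ENNReal.toReal_eq_toReal_iff' (ENNReal.sum_ne_top.2 fun i _ => chi_inv_ne_top (hμ i) hp)
    (ENNReal.sub_ne_top (ENNReal.natCast_ne_top n)),
    ENNReal.toReal_sum fun i _ => chi_inv_ne_top (hμ i) hp,
    ENNReal.toReal_sub_of_le (by exact_mod_cast hn) (ENNReal.natCast_ne_top n)]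
  simp [invChi]

variable [∀ i, Nontrivial (G i)]

lemma sum_invChi_lt (hf : ∀ i, Subgroup.closure (range (f i)) = ⊤)
    (hμ : ∀ i, ∀ p ∈ Icc (0 : ℝ) 1, IsBernoulli p (μ i p)) {p p' : ℝ}
    (hp : p ∈ Icc (0 : ℝ) 1) (hp' : p' ∈ Icc (0 : ℝ) 1) (h : p < p')
    (h0 : 0 < ∑ i, invChi (f i) (μ i p)) :
    ∑ i, invChi (f i) (μ i p') < ∑ i, invChi (f i) (μ i p) := by
  obtain ⟨i, -, hi⟩ := Finset.exists_lt_of_sum_lt (s := Finset.univ) (f := fun _ => (0 : ℝ))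
    (g := fun i => invChi (f i) (μ i p)) (by simpa using h0)
  obtain ⟨s, hs⟩ := exists_ne_one_of_closure_range (hf i)
  exact Finset.sum_lt_sum (fun j _ => antitoneOn_invChi (hμ j) hp hp' h.le)
    ⟨i, Finset.mem_univ i, invChi_lt (hμ i) hs hp hp' h hi⟩

lemma exists_sum_invChi_eq (hn : 2 ≤ n) (hf : ∀ i, Subgroup.closure (range (f i)) = ⊤)
    (hμ : ∀ i, ∀ p ∈ Icc (0 : ℝ) 1, IsBernoulli p (μ i p)) :
    ∃ p₀ ∈ Ioc (0 : ℝ) 1, ∑ i, invChi (f i) (μ i p₀) = n - 1 := by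
  have hn' : (2 : ℝ) ≤ n := by exact_mod_cast hn
  have hcont : ContinuousOn (fun p => ∑ i, invChi (f i) (μ i p)) (Icc 0 1) :=
    continuousOn_finsetSum _ fun i _ => continuousOn_invChi (hf i) (hμ i)
  have h0 : ∑ i, invChi (f i) (μ i 0) = n := by simp [fun i => invChi_zero (f := f i) (hμ i)]
  have h1 : ∑ i, invChi (f i) (μ i 1) ≤ n - 1 := by
    refine (Finset.sum_le_sum fun i _ => invChi_one_le (hf i) (hμ i)).trans ?_
    simp only [Finset.sum_const, Finset.card_univ, Fintype.card_fin, nsmul_eq_mul]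
    linarith
  obtain ⟨p₀, hp₀, h⟩ := intermediate_value_Icc' zero_le_one hcont
    (show (n : ℝ) - 1 ∈ _ from ⟨h1, by simp [h0]⟩)
  refine ⟨p₀, ⟨hp₀.1.lt_of_ne ?_, hp₀.2⟩, h⟩
  rintro rfl
  simp only [h0] at h
  linarith

end Root

section FreeProduct

open Monoid

variable {κ : Type*} {G ι : κ → Type*} [∀ i, Group (G i)]

/-- The generators of a free product coming from families of generators of the factors. -/
def freeGens (f : ∀ i, ι i → G i) : (Σ i, ι i) → CoprodI G := fun x => CoprodI.of (f x.1 x.2)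

/-- The canonical embedding of the edges of a factor. -/
def ofEdge (i : κ) (e : G i × ι i) : CoprodI G × (Σ i, ι i) := (CoprodI.of e.1, ⟨i, e.2⟩)

lemma ofEdge_injective (i : κ) : Function.Injective (ofEdge i : G i × ι i → _) := by
  rintro ⟨a, s⟩ ⟨b, t⟩ h
  simp only [ofEdge, Prod.mk.injEq, Sigma.mk.injEq, heq_eq_eq, true_and] at h
  exact Prod.ext (CoprodI.of_injective i h.1) h.2

/-- The restriction of a configuration to the copy of a factor containing the identity. -/
def loc (i : κ) (ω : Config (CoprodI G × (Σ i, ι i))) : Config (G i × ι i) := fun e =>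
  ω (ofEdge i e)

lemma measurable_loc (i : κ) :
    Measurable (loc i : Config (CoprodI G × (Σ i, ι i)) → Config (G i × ι i)) :=
  measurable_reindex _

lemma loc_shift (i : κ) (u : G i) (ω : Config (CoprodI G × (Σ i, ι i))) :
    loc i (shift (CoprodI.of u) ω) = shift u (loc i ω) := by
  funext e
  simp [loc, shift, ofEdge]

lemma conn_of_conn_loc {f : ∀ i, ι i → G i} {i : κ} {ω : Config (CoprodI G × (Σ i, ι i))}
    {x y : G i} (h : Conn (f i) (loc i ω) x y) :
    Conn (freeGens f) ω (CoprodI.of x) (CoprodI.of y) := by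
  refine Relation.ReflTransGen.lift (CoprodI.of ·) (fun a b hab => ?_) _ _ h
  obtain ⟨s, ⟨h, rfl⟩ | ⟨h, rfl⟩⟩ := hab
  · exact ⟨⟨i, s⟩, .inl ⟨h, by simp [freeGens]⟩⟩
  · exact ⟨⟨i, s⟩, .inr ⟨h, by simp [freeGens]⟩⟩

lemma Step.exists_loc {f : ∀ i, ι i → G i} {ω : Config (CoprodI G × (Σ i, ι i))}
    {a c : CoprodI G} (h : Step (freeGens f) ω a c) :
    ∃ i, ∃ u : G i, c = a * CoprodI.of u ∧ Step (f i) (loc i (shift a ω)) 1 u := by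
  obtain ⟨⟨i, s⟩, ⟨h, rfl⟩ | ⟨h, rfl⟩⟩ := h
  · exact ⟨i, f i s, rfl, s, .inl ⟨by simpa [loc, shift, ofEdge] using h, by simp⟩⟩
  · refine ⟨i, (f i s)⁻¹, by simp [freeGens], s, .inr ⟨?_, by simp⟩⟩
    simpa [loc, shift, ofEdge, freeGens] using h

variable {p : ℝ} {μ : Measure (Config (CoprodI G × (Σ i, ι i)))}

lemma IsBernoulli.measure_loc (hp : p ∈ Icc (0 : ℝ) 1) (hμ : IsBernoulli p μ) (i : κ)
    {ν : Measure (Config (G i × ι i))} (hν : IsBernoulli p ν) {P : Config (G i × ι i) → Prop}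
    (hP : MeasurableSet {ω | P ω}) : μ {ω | P (loc i ω)} = ν {ω | P ω} := by
  rw [hν.unique hp (hμ.map_reindex (ofEdge_injective i)),
    Measure.map_apply (measurable_reindex _) hP]
  rfl

/-- The successive syllables of the word `l` are realised by open connections in the
corresponding copies of the factors. -/
def SylConn (f : ∀ i, ι i → G i) :
    List (Σ i, G i) → Config (CoprodI G × (Σ i, ι i)) → Prop
  | [], _ => True
  | ⟨i, g⟩ :: l, ω => Conn (f i) (loc i ω) 1 g ∧ SylConn f l (shift (CoprodI.of g) ω)

lemma measurableSet_sylConn [∀ i, Countable (G i)] [∀ i, Countable (ι i)] (f : ∀ i, ι i → G i)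
    (l : List (Σ i, G i)) : MeasurableSet {ω | SylConn f l ω} := by
  induction l with
  | nil => exact MeasurableSet.const _
  | cons x l ih =>
    exact MeasurableSet.inter (measurable_loc x.1 (measurableSet_conn (f x.1) 1 x.2))
      (measurable_shift (CoprodI.of x.2) ih)

lemma dependsOn_conn_loc (f : ∀ i, ι i → G i) (i : κ) (g : G i) :
    DependsOn (fun ω : Config (CoprodI G × (Σ i, ι i)) => Conn (f i) (loc i ω) 1 g)
      (range (ofEdge i)) := by
  intro ω ω' h
  have : loc i ω = loc i ω' := funext fun e => h _ ⟨e, rfl⟩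
  simp only [this]

lemma DependsOn.comp_shift {α G ι : Type*} [Group G] {P : Config (G × ι) → α} {X : Set (G × ι)}
    (h : DependsOn P X) (a : G) :
    DependsOn (fun ω => P (shift a ω)) ((fun e : G × ι => (a * e.1, e.2)) '' X) :=
  fun _ _ hω => h fun _ he => hω _ (mem_image_of_mem _ he)

variable [DecidableEq κ] [∀ i, DecidableEq (G i)]

/-- The factor in which the first syllable of an edge lies. -/
def edgeIdx (e : CoprodI G × (Σ i, ι i)) : κ := ((CoprodI.Word.equiv e.1).fstIdx).getD e.2.1

lemma word_of_mul {i : κ} (h : G i) (a : CoprodI G) :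
    CoprodI.Word.equiv (CoprodI.of h * a) = CoprodI.of h • CoprodI.Word.equiv a := by
  simp [CoprodI.Word.equiv, mul_smul]

lemma word_one : CoprodI.Word.equiv (1 : CoprodI G) = CoprodI.Word.empty := by
  simp [CoprodI.Word.equiv]

lemma fstIdx_of_smul {i : κ} {h : G i} (hh : h ≠ 1) {w : CoprodI.Word G} (hw : w.fstIdx ≠ some i) :
    (CoprodI.of h • w).fstIdx = some i := by
  rw [← CoprodI.Word.cons_eq_smul (h1 := hw) (h2 := hh), CoprodI.Word.fstIdx_cons]

lemma edgeIdx_ofEdge (i : κ) (e : G i × ι i) : edgeIdx (ofEdge i e) = i := by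
  obtain ⟨h, s⟩ := e
  have hempty : (CoprodI.Word.empty : CoprodI.Word G).fstIdx ≠ some i := by
    simp [CoprodI.Word.fstIdx]
  simp only [edgeIdx, ofEdge]
  rw [← mul_one (CoprodI.of h), word_of_mul, word_one]
  by_cases hh : h = 1
  · subst hh
    simp [CoprodI.Word.fstIdx]
  · simp [fstIdx_of_smul hh hempty]

lemma edgeIdx_of_mul {j : κ} {g : G j} (hg : g ≠ 1) {e : CoprodI G × (Σ i, ι i)}
    (he : edgeIdx e ≠ j) : edgeIdx (CoprodI.of g * e.1, e.2) = j := by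
  have hw : (CoprodI.Word.equiv e.1).fstIdx ≠ some j := fun h => he (by simp [edgeIdx, h])
  simp [edgeIdx, word_of_mul, fstIdx_of_smul hg hw]

lemma sylConn_of_smul {f : ∀ i, ι i → G i} {i : κ} (h : G i) {w : CoprodI.Word G}
    (hw : w.fstIdx ≠ some i) (ω : Config (CoprodI G × (Σ i, ι i))) :
    SylConn f (CoprodI.of h • w).toList ω ↔
      Conn (f i) (loc i ω) 1 h ∧ SylConn f w.toList (shift (CoprodI.of h) ω) := by
  by_cases hh : h = 1
  · subst hh
    simp only [map_one, one_smul, shift_one, iff_and_self]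
    exact fun _ => .refl
  · rw [← CoprodI.Word.cons_eq_smul (h1 := hw) (h2 := hh)]
    rfl

lemma Conn.sylConn {f : ∀ i, ι i → G i} {ω : Config (CoprodI G × (Σ i, ι i))} {a x : CoprodI G}
    (h : Conn (freeGens f) ω a x) :
    SylConn f (CoprodI.Word.equiv (a⁻¹ * x)).toList (shift a ω) := by
  induction h using Relation.ReflTransGen.head_induction_on with
  | refl =>
    rw [inv_mul_cancel, word_one]
    trivial
  | @head a c hac _ ih =>
    obtain ⟨i, u, rfl, hs⟩ := hac.exists_loc
    set w := CoprodI.Word.equiv ((a * CoprodI.of u)⁻¹ * x) with hwdef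
    set q := CoprodI.Word.equivPair i w with hq
    have hwq : w = CoprodI.of q.head • q.tail :=
      (CoprodI.Word.equivPair_head_smul_equivPair_tail w).symm
    rw [hwq, sylConn_of_smul _ q.fstIdx_ne] at ih
    have hax : CoprodI.Word.equiv (a⁻¹ * x) = CoprodI.of (u * q.head) • q.tail := by
      rw [MonoidHom.map_mul, mul_smul, ← hwq, hwdef, ← word_of_mul]
      congr 1
      group
    rw [hax, sylConn_of_smul _ q.fstIdx_ne]
    refine ⟨.head hs ?_, ?_⟩
    · have := ih.1
      rw [← shift_shift, loc_shift, conn_shift] at this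
      rwa [mul_one] at this
    · have := ih.2
      rw [shift_shift] at this ⊢
      rwa [map_mul, ← mul_assoc]

lemma disjoint_range_ofEdge_image {i : κ} (g : G i) :
    Disjoint (range (ofEdge i))
      ((fun e : CoprodI G × (Σ i, ι i) => (CoprodI.of g * e.1, e.2)) '' {e | edgeIdx e ≠ i}) := by
  rw [Set.disjoint_left]
  rintro _ ⟨⟨h, s⟩, rfl⟩ ⟨e, he, hee⟩
  simp only [ofEdge, Prod.mk.injEq] at hee
  refine he ?_
  have : e = ofEdge i (g⁻¹ * h, s) := Prod.ext (by simp [ofEdge, ← hee.1]) hee.2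
  rw [this, edgeIdx_ofEdge]

lemma dependsOn_sylConn (f : ∀ i, ι i → G i) (w : CoprodI.Word G) {i : κ}
    (hw : w.fstIdx ≠ some i) : DependsOn (SylConn f w.toList) {e | edgeIdx e ≠ i} := by
  induction w using CoprodI.Word.consRecOn generalizing i with
  | empty => exact fun _ _ _ => rfl
  | cons j g w h1 h2 ih =>
    have hji : j ≠ i := by simpa using hw
    intro ω ω' h
    have hl : (Conn (f j) (loc j ω) 1 g) = (Conn (f j) (loc j ω') 1 g) :=
      dependsOn_conn_loc f j g (by
        rintro _ ⟨e, rfl⟩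
        exact h _ (by simpa [edgeIdx_ofEdge] using hji))
    have hs := (ih h1).comp_shift (CoprodI.of g) (x := ω) (y := ω') (by
      rintro _ ⟨e, he, rfl⟩
      exact h _ (by simpa [edgeIdx_of_mul h2 he] using hji))
    exact congrArg₂ And hl hs

variable [∀ i, Countable (G i)] [∀ i, Countable (ι i)]

lemma measure_sylConn_of_smul (hp : p ∈ Icc (0 : ℝ) 1) (hμ : IsBernoulli p μ)
    (f : ∀ i, ι i → G i) {i : κ} (g : G i) {w : CoprodI.Word G} (hw : w.fstIdx ≠ some i) :
    μ {ω | SylConn f (CoprodI.of g • w).toList ω} =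
      μ {ω | Conn (f i) (loc i ω) 1 g} * μ {ω | SylConn f w.toList ω} := by
  simp only [sylConn_of_smul g hw]
  have hm1 : MeasurableSet {ω : Config (CoprodI G × (Σ i, ι i)) | Conn (f i) (loc i ω) 1 g} :=
    measurable_loc i (measurableSet_conn (f i) 1 g)
  have hm2 : MeasurableSet {ω : Config (CoprodI G × (Σ i, ι i)) |
      SylConn f w.toList (shift (CoprodI.of g) ω)} :=
    measurable_shift _ (measurableSet_sylConn f w.toList)
  rw [measure_and_of_dependsOn (hμ.iIndepFun hp) (disjoint_range_ofEdge_image g) hm1 hm2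
    (dependsOn_conn_loc f i g)
    ((dependsOn_sylConn f w hw).comp_shift (CoprodI.of g)),
    hμ.measure_shift hp _ (measurableSet_sylConn f w.toList)]

end FreeProduct

lemma invChi_le_one {G ι : Type*} [Group G] [Countable G] [Countable ι] {p : ℝ}
    {f : ι → G} {ν : Measure (Config (G × ι))} (hν : IsBernoulli p ν) : invChi f ν ≤ 1 := by
  have := hν.isProbabilityMeasure
  have := ENNReal.toReal_mono ENNReal.one_ne_top (ENNReal.inv_le_one.2 (one_le_chi f ν))
  simpa [invChi] using this

instance {κ : Type*} {G : κ → Type*} [∀ i, Group (G i)] [Countable κ] [∀ i, Countable (G i)] :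
    Countable (Monoid.CoprodI G) := by
  classical
  exact Function.Injective.countable
    (f := fun x => (Monoid.CoprodI.Word.equiv (M := G) x).toList) fun _ _ h =>
      Monoid.CoprodI.Word.equiv.injective (Monoid.CoprodI.Word.ext h)

section

open Monoid

variable {κ : Type*} {G ι : κ → Type*} [∀ i, Group (G i)] [∀ i, DecidableEq (G i)]
  [∀ i, Countable (G i)] [∀ i, Countable (ι i)] {f : ∀ i, ι i → G i} {p : ℝ}
  {μ : Measure (Config (CoprodI G × (Σ i, ι i)))} {ν : ∀ i, Measure (Config (G i × ι i))}

lemma tsum_conn_loc_ne_one (hp : p ∈ Icc (0 : ℝ) 1) (hμ : IsBernoulli p μ)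
    (hν : ∀ i, IsBernoulli p (ν i)) (j : κ) (hb : 0 < invChi (f j) (ν j)) :
    (∑' g : G j, if g = 1 then 0 else μ {ω | Conn (f j) (loc j ω) 1 g}) =
      ENNReal.ofReal ((1 - invChi (f j) (ν j)) / invChi (f j) (ν j)) := by
  have := (hν j).isProbabilityMeasure
  have h1 : (ν j) {ω | Conn (f j) ω 1 1} = 1 := by
    have : {ω | Conn (f j) ω 1 1} = univ := eq_univ_of_forall fun ω => Relation.ReflTransGen.refl
    rw [this, measure_univ]
  have hchi := chi_eq_tsum (f j) (ν j)
  rw [ENNReal.tsum_eq_add_tsum_ite 1, h1] at hchi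
  simp only [hμ.measure_loc hp j (hν j) (measurableSet_conn (f j) 1 _)]
  have hne : chi (f j) (ν j) ≠ ∞ := by
    intro h
    simp [invChi, h] at hb
  have hchi' : chi (f j) (ν j) = ENNReal.ofReal (1 / invChi (f j) (ν j)) := by
    rw [invChi, ENNReal.toReal_inv, one_div, inv_inv, ENNReal.ofReal_toReal hne]
  rw [hchi'] at hchi
  have : (1 - invChi (f j) (ν j)) / invChi (f j) (ν j) = 1 / invChi (f j) (ν j) - 1 := by
    field_simp
  rw [this, ENNReal.ofReal_sub _ zero_le_one, ENNReal.ofReal_one, hchi,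
    ENNReal.add_sub_cancel_left ENNReal.one_ne_top]
  exact tsum_congr fun _ => by split_ifs <;> rfl

end

section Subcritical

open Monoid

variable {κ : Type*} {G ι : κ → Type*} [∀ i, Group (G i)] [DecidableEq κ]
  {p : ℝ} {μ : Measure (Config (CoprodI G × (Σ i, ι i)))}

/-- The expected number of words having all syllables connected, with fewer than `k` syllables,
the first of which does not lie in the factor `i`. -/
noncomputable def expWords (f : ∀ i, ι i → G i) (μ : Measure (Config (CoprodI G × (Σ i, ι i))))
    (k : ℕ) (i : κ) : ℝ≥0∞ :=
  ∑' w : CoprodI.Word G, if w.fstIdx ≠ some i ∧ w.toList.length < k then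
    μ {ω | SylConn f w.toList ω} else 0

lemma tsum_fstIdx_ne_le {f : ∀ i, ι i → G i} {i : κ} {c : ℝ≥0∞} (h : ∀ k, expWords f μ k i ≤ c) :
    ∑' w : CoprodI.Word G, (if w.fstIdx ≠ some i then μ {ω | SylConn f w.toList ω} else 0) ≤ c := by
  rw [ENNReal.tsum_eq_iSup_sum]
  refine iSup_le fun T => ?_
  refine le_trans ?_ (h (T.sup (fun w => w.toList.length) + 1))
  refine le_trans (Finset.sum_le_sum fun w hw => ?_) (ENNReal.sum_le_tsum T)
  have : w.toList.length < T.sup (fun w => w.toList.length) + 1 :=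
    Nat.lt_succ_of_le (Finset.le_sup (f := fun w : CoprodI.Word G => w.toList.length) hw)
  simp [this]

variable [∀ i, DecidableEq (G i)] [∀ i, Countable (G i)] [∀ i, Countable (ι i)]

lemma tsum_fstIdx_eq_le (hp : p ∈ Icc (0 : ℝ) 1) (hμ : IsBernoulli p μ)
    (f : ∀ i, ι i → G i) (k : ℕ) (j : κ) :
    ∑' w : CoprodI.Word G, (if w.fstIdx = some j ∧ w.toList.length < k + 1 then
      μ {ω | SylConn f w.toList ω} else 0) ≤
    (∑' g : G j, if g = 1 then 0 else μ {ω | Conn (f j) (loc j ω) 1 g}) * expWords f μ k j := by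
  let Φ : G j × CoprodI.Word G → ℝ≥0∞ := fun x =>
    (if x.1 = 1 then 0 else μ {ω | Conn (f j) (loc j ω) 1 x.1}) *
      if x.2.fstIdx ≠ some j ∧ x.2.toList.length < k then μ {ω | SylConn f x.2.toList ω} else 0
  let dec : CoprodI.Word G → G j × CoprodI.Word G := fun w =>
    ((CoprodI.Word.equivPair j w).head, (CoprodI.Word.equivPair j w).tail)
  have hdec : Function.Injective dec := by
    intro w w' h
    simp only [dec, Prod.mk.injEq] at h
    rw [← CoprodI.Word.equivPair_head_smul_equivPair_tail (i := j) w, h.1, h.2,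
      CoprodI.Word.equivPair_head_smul_equivPair_tail]
  calc _ ≤ ∑' w, Φ (dec w) := ENNReal.tsum_le_tsum fun w => ?_
    _ ≤ ∑' x, Φ x := ENNReal.tsum_comp_le_tsum_of_injective hdec Φ
    _ = _ := by
      rw [ENNReal.tsum_prod', expWords, ← ENNReal.tsum_mul_right]
      simp only [Φ, ENNReal.tsum_mul_left]
  split_ifs with hw
  swap
  · exact zero_le
  set q := CoprodI.Word.equivPair j w with hq
  have hwq : CoprodI.of q.head • q.tail = w := CoprodI.Word.equivPair_head_smul_equivPair_tail w
  have hhead : q.head ≠ 1 := by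
    intro h
    rw [h, map_one, one_smul] at hwq
    exact q.fstIdx_ne (hwq ▸ hw.1)
  have hlen : q.tail.toList.length < k := by
    have h := hw.2
    rw [← hwq, ← CoprodI.Word.cons_eq_smul (h1 := q.fstIdx_ne) (h2 := hhead)] at h
    simpa [CoprodI.Word.cons] using h
  simp only [Φ, dec]
  rw [← hq, if_neg hhead, if_pos ⟨q.fstIdx_ne, hlen⟩,
    ← measure_sylConn_of_smul hp hμ f q.head q.fstIdx_ne, hwq]

lemma expWords_succ_le [Fintype κ] (hp : p ∈ Icc (0 : ℝ) 1) (hμ : IsBernoulli p μ)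
    (f : ∀ i, ι i → G i) (k : ℕ) (i : κ) :
    expWords f μ (k + 1) i ≤ 1 + ∑ j ∈ Finset.univ.erase i,
      (∑' g : G j, if g = 1 then 0 else μ {ω | Conn (f j) (loc j ω) 1 g}) * expWords f μ k j := by
  have := hμ.isProbabilityMeasure
  calc expWords f μ (k + 1) i ≤ ∑' w : CoprodI.Word G,
        ((if w = CoprodI.Word.empty then 1 else 0) + ∑ j ∈ Finset.univ.erase i,
          if w.fstIdx = some j ∧ w.toList.length < k + 1 then
            μ {ω | SylConn f w.toList ω} else 0) := by
        refine ENNReal.tsum_le_tsum fun w => ?_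
        split_ifs with h1 h2
        · exact prob_le_one.trans le_self_add
        · obtain ⟨j, hj⟩ : ∃ j, w.fstIdx = some j := by
            rcases h : w.fstIdx with _ | j
            · refine absurd (CoprodI.Word.ext ?_) h2
              simpa [CoprodI.Word.fstIdx] using h
            · exact ⟨j, rfl⟩
          have hji : j ∈ Finset.univ.erase i := by
            simp only [Finset.mem_erase, Finset.mem_univ, and_true]
            rintro rfl
            exact h1.1 hj
          rw [zero_add]
          exact (by simp [hj, h1.2] : _ = _).trans_le
            (Finset.single_le_sum (f := fun j => if w.fstIdx = some j ∧ w.toList.length < k + 1 then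
              μ {ω | SylConn f w.toList ω} else 0) (fun _ _ => zero_le) hji)
        · exact zero_le
        · exact zero_le
    _ ≤ _ := by
        rw [ENNReal.tsum_add, tsum_ite_eq, Summable.tsum_finsetSum fun _ _ => ENNReal.summable]
        gcongr with j
        exact tsum_fstIdx_eq_le hp hμ f k j

variable [Fintype κ] {f : ∀ i, ι i → G i} {ν : ∀ i, Measure (Config (G i × ι i))}

lemma expWords_le (hp : p ∈ Icc (0 : ℝ) 1) (hμ : IsBernoulli p μ) (hν : ∀ i, IsBernoulli p (ν i))
    (hsum : (Fintype.card κ : ℝ) - 1 < ∑ i, invChi (f i) (ν i)) (k : ℕ) (i : κ) :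
    expWords f μ k i ≤ ENNReal.ofReal
      (invChi (f i) (ν i) / (∑ j, invChi (f j) (ν j) - (Fintype.card κ - 1))) := by
  set b : κ → ℝ := fun i => invChi (f i) (ν i) with hb
  set δ := ∑ j, b j - ((Fintype.card κ : ℝ) - 1) with hδ
  have hδ0 : 0 < δ := by simp only [hδ]; linarith
  have hb1 : ∀ i, b i ≤ 1 := fun i => invChi_le_one (hν i)
  have hcompl : ∀ i, ∑ j ∈ Finset.univ.erase i, (1 - b j) = b i - δ := by
    intro i
    have h := Finset.sum_erase_add Finset.univ (fun j => 1 - b j) (Finset.mem_univ i)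
    have h' : ∑ j, (1 - b j) = Fintype.card κ - ∑ j, b j := by simp [Finset.sum_sub_distrib]
    rw [hδ]
    linarith
  have hb0 : ∀ i, 0 < b i := by
    intro i
    have := Finset.sum_nonneg (s := Finset.univ.erase i) (f := fun j => 1 - b j)
      fun j _ => by linarith [hb1 j]
    linarith [hcompl i]
  induction k generalizing i with
  | zero => simp [expWords]
  | succ k ih =>
    refine (expWords_succ_le hp hμ f k i).trans ?_
    calc _ ≤ 1 + ∑ j ∈ Finset.univ.erase i,
          ENNReal.ofReal ((1 - b j) / b j) * ENNReal.ofReal (b j / δ) := by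
          gcongr with j
          · exact (tsum_conn_loc_ne_one hp hμ hν j (hb0 j)).le
          · exact ih j
      _ = ENNReal.ofReal (1 + ∑ j ∈ Finset.univ.erase i, (1 - b j) / δ) := by
          rw [ENNReal.ofReal_add zero_le_one (Finset.sum_nonneg fun j _ =>
            div_nonneg (by linarith [hb1 j]) hδ0.le), ENNReal.ofReal_one,
            ENNReal.ofReal_sum_of_nonneg fun j _ => div_nonneg (by linarith [hb1 j]) hδ0.le]
          congr 1
          refine Finset.sum_congr rfl fun j _ => ?_
          rw [← ENNReal.ofReal_mul (div_nonneg (by linarith [hb1 j]) (hb0 j).le)]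
          congr 1
          have := (hb0 j).ne'
          field_simp
      _ = _ := by
          rw [← Finset.sum_div, hcompl]
          congr 1
          field_simp
          ring

lemma theta_eq_zero [Nontrivial κ] (hp : p ∈ Icc (0 : ℝ) 1) (hμ : IsBernoulli p μ)
    (hν : ∀ i, IsBernoulli p (ν i))
    (hsum : (Fintype.card κ : ℝ) - 1 < ∑ i, invChi (f i) (ν i)) :
    theta (freeGens f) μ = 0 := by
  obtain ⟨i, j, hij⟩ := exists_pair_ne κ
  have hfin : ∑' x : CoprodI G, μ {ω | SylConn f (CoprodI.Word.equiv x).toList ω} ≠ ∞ := by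
    rw [Equiv.tsum_eq CoprodI.Word.equiv fun w => μ {ω | SylConn f w.toList ω}]
    refine ne_top_of_le_ne_top ?_ (b := _ + _) (le_trans (ENNReal.tsum_le_tsum fun w => ?_)
      (ENNReal.tsum_add.trans_le (add_le_add
        (tsum_fstIdx_ne_le fun k => expWords_le hp hμ hν hsum k i)
        (tsum_fstIdx_ne_le fun k => expWords_le hp hμ hν hsum k j))))
    · exact ENNReal.add_ne_top.2 ⟨ENNReal.ofReal_ne_top, ENNReal.ofReal_ne_top⟩
    · by_cases h : w.fstIdx = some i
      · have : w.fstIdx ≠ some j := by rw [h]; simpa using hij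
        simp [this]
      · simp [h]
  have hae := ae_finite_setOfPred_mem hfin
  rw [theta, ENNReal.toReal_eq_zero_iff]
  left
  refine measure_mono_null (fun ω hω => ?_) hae
  refine fun hf => hω (hf.subset fun x hx => ?_)
  have := Conn.sylConn (a := 1) hx
  rwa [inv_one, one_mul, shift_one] at this

end Subcritical

lemma exp_neg_le {x : ℝ} (hx : 0 ≤ x) : Real.exp (-x) ≤ 1 - x + x ^ 2 := by
  rcases le_total x 1 with h | h
  · have := Real.abs_exp_sub_one_sub_id_le (x := -x) (by rwa [abs_neg, abs_of_nonneg hx])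
    nlinarith [le_of_abs_le this]
  · have : Real.exp (-x) ≤ 1 := Real.exp_le_one_iff.2 (by linarith)
    nlinarith

lemma exists_pos_mul_le {κ : Type*} [Fintype κ] [DecidableEq κ] {a v : κ → ℝ} (m : κ → ℝ)
    (ha : ∀ i, 0 ≤ a i) (hv : ∀ i, v i = a i / (1 + a i)) (hV : 1 < ∑ i, v i) :
    ∃ ε : ℝ, 0 < ε ∧ ε ≤ 1 ∧ ∀ i, v i = 0 ∨
      v i ≤ (∑ j ∈ Finset.univ.erase i, v j) * a i -
        ε * ((∑ j ∈ Finset.univ.erase i, v j) * m i) ^ 2 := by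
  have key : ∀ i, ∀ᶠ ε : ℝ in 𝓝[>] 0, v i = 0 ∨
      v i ≤ (∑ j ∈ Finset.univ.erase i, v j) * a i -
        ε * ((∑ j ∈ Finset.univ.erase i, v j) * m i) ^ 2 := by
    intro i
    set W := ∑ j ∈ Finset.univ.erase i, v j with hW
    rcases (ha i).eq_or_lt with h0 | h0
    · exact Eventually.of_forall fun ε => .inl (by rw [hv, ← h0, zero_div])
    have hW' : W = ∑ j, v j - v i := by
      rw [hW, ← Finset.sum_erase_add Finset.univ v (Finset.mem_univ i), add_sub_cancel_right]
    have hlt : v i < W * a i := by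
      have h1 : v i * (1 + a i) = a i := by
        rw [hv]
        have : 1 + a i ≠ 0 := by linarith
        field_simp
      rw [hW']
      nlinarith
    have ht : Tendsto (fun ε : ℝ => W * a i - ε * (W * m i) ^ 2) (𝓝[>] 0) (𝓝 (W * a i)) := by
      have : Continuous fun ε : ℝ => W * a i - ε * (W * m i) ^ 2 := by fun_prop
      simpa using (this.tendsto 0).mono_left nhdsWithin_le_nhds
    exact (ht.eventually_const_lt hlt).mono fun ε h => .inr h.le
  have h1 : ∀ᶠ ε : ℝ in 𝓝[>] 0, ε ≤ 1 :=
    nhdsWithin_le_nhds (eventually_le_nhds zero_lt_one)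
  obtain ⟨ε, ⟨h, h'⟩, h0⟩ :=
    (((eventually_all.2 key).and h1).and (eventually_mem_nhdsWithin (α := ℝ))).exists
  exact ⟨ε, h0, h', h⟩

section Supercritical

open Monoid

variable {κ : Type*} {G ι : κ → Type*} [∀ i, Group (G i)]

/-- There is a reduced word of length `k`, starting in the factor `i` and with syllables in the
prescribed finite sets, all of whose syllables are connected. -/
def Deep (f : ∀ i, ι i → G i) (F : ∀ i, Finset (G i)) :
    ℕ → κ → Config (CoprodI G × (Σ i, ι i)) → Prop
  | 0, _, _ => True
  | k + 1, i, ω => ∃ g ∈ F i, Conn (f i) (loc i ω) 1 g ∧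
      ∃ j, j ≠ i ∧ Deep f F k j (shift (CoprodI.of g) ω)

variable {f : ∀ i, ι i → G i} {F : ∀ i, Finset (G i)}

lemma Deep.of_succ {k : ℕ} {i : κ} {ω : Config (CoprodI G × (Σ i, ι i))}
    (h : Deep f F (k + 1) i ω) : Deep f F k i ω := by
  induction k generalizing i ω with
  | zero => trivial
  | succ k ih =>
    obtain ⟨g, hg, hc, j, hj, hd⟩ := h
    exact ⟨g, hg, hc, j, hj, ih hd⟩

lemma measurableSet_deep [Countable κ] [∀ i, Countable (G i)] [∀ i, Countable (ι i)] (k : ℕ)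
    (i : κ) : MeasurableSet {ω | Deep f F k i ω} := by
  induction k generalizing i with
  | zero => exact MeasurableSet.const _
  | succ k ih =>
    have : {ω | Deep f F (k + 1) i ω} = ⋃ g ∈ F i, {ω | Conn (f i) (loc i ω) 1 g} ∩
        ⋃ j ∈ {j : κ | j ≠ i}, {ω | Deep f F k j (shift (CoprodI.of g) ω)} := by
      ext ω
      simp only [Deep, mem_ofPred_eq, mem_iUnion, mem_inter_iff, exists_prop]
    rw [this]
    refine Finset.measurableSet_biUnion _ fun g _ => .inter ?_ ?_
    · exact measurable_loc i (measurableSet_conn (f i) 1 g)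
    · exact MeasurableSet.biUnion (to_countable _) fun j _ => measurable_shift _ (ih j)

lemma Deep.exists_word (hF : ∀ i, 1 ∉ F i) {k : ℕ} {i : κ}
    {ω : Config (CoprodI G × (Σ i, ι i))} (h : Deep f F k i ω) :
    ∃ w : CoprodI.Word G, w.toList.length = k ∧ (∀ j, w.fstIdx = some j → j = i) ∧
      Conn (freeGens f) ω 1 w.prod := by
  induction k generalizing i ω with
  | zero => exact ⟨CoprodI.Word.empty, rfl, by simp [CoprodI.Word.fstIdx], .refl⟩
  | succ k ih =>
    obtain ⟨g, hg, hc, j, hj, hd⟩ := h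
    obtain ⟨w, hw, hwj, hcw⟩ := ih hd
    refine ⟨CoprodI.Word.cons g w (fun h => hj (hwj i h).symm) (fun h => hF i (h ▸ hg)),
      by simp [CoprodI.Word.cons, hw], fun j' h => ?_, ?_⟩
    · simpa [eq_comm] using h
    · have h1 := conn_of_conn_loc hc
      rw [map_one] at h1
      rw [conn_shift, mul_one] at hcw
      rw [CoprodI.Word.prod_cons]
      exact h1.trans hcw

lemma infinite_cluster_of_deep (hF : ∀ i, 1 ∉ F i) {i : κ}
    {ω : Config (CoprodI G × (Σ i, ι i))} (h : ∀ k, Deep f F k i ω) :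
    (cluster (freeGens f) ω).Infinite := by
  classical
  refine Set.Infinite.of_image (fun x => (CoprodI.Word.equiv x).toList.length) ?_
  refine infinite_univ.mono fun k _ => ?_
  obtain ⟨w, hw, -, hc⟩ := (h k).exists_word hF
  refine ⟨w.prod, hc, ?_⟩
  have : CoprodI.Word.equiv w.prod = w := CoprodI.Word.equiv.apply_symm_apply w
  simp only [this, hw]

section Hits

/-- The vertices of a finite set in a factor which are connected to the identity. -/
noncomputable def hits (f : ∀ i, ι i → G i) (F : ∀ i, Finset (G i)) (i : κ)
    (ω : Config (CoprodI G × (Σ i, ι i))) : Finset (G i) :=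
  open Classical in (F i).filter fun g => Conn (f i) (loc i ω) 1 g

lemma hits_eq_iff {i : κ} {A : Finset (G i)} (hA : A ∈ (F i).powerset)
    {ω : Config (CoprodI G × (Σ i, ι i))} :
    hits f F i ω = A ↔ ∀ g ∈ F i, (Conn (f i) (loc i ω) 1 g ↔ g ∈ A) := by
  rw [Finset.mem_powerset] at hA
  simp only [hits, Finset.ext_iff, Finset.mem_filter]
  exact forall_congr' fun g => ⟨fun h hg => by rw [← h, and_iff_right hg], fun h =>
    ⟨fun h' => (h h'.1).1 h'.2, fun h' => ⟨hA h', (h (hA h')).2 h'⟩⟩⟩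

lemma dependsOn_hits (i : κ) :
    DependsOn (hits f F i) (range (ofEdge i)) := by
  intro ω ω' h
  have : loc i ω = loc i ω' := funext fun e => h _ ⟨e, rfl⟩
  classical
  simp only [hits, this]

variable [∀ i, Countable (G i)] [∀ i, Countable (ι i)]
  {μ : Measure (Config (CoprodI G × (Σ i, ι i)))}

lemma measurableSet_hits_eq {i : κ} {A : Finset (G i)} (hA : A ∈ (F i).powerset) :
    MeasurableSet {ω | hits f F i ω = A} := by
  simp only [hits_eq_iff hA]
  refine measurableSet_finset_forall (fun g => ?_) (F i)
  have : MeasurableSet {ω : Config (CoprodI G × (Σ i, ι i)) | Conn (f i) (loc i ω) 1 g} :=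
    measurable_loc i (measurableSet_conn (f i) 1 g)
  by_cases hg : g ∈ A
  · simpa [hg] using this
  · simp only [hg, iff_false]
    exact this.compl

lemma measureReal_eq_sum_hits [IsProbabilityMeasure μ] (i : κ)
    (Q : Set (Config (CoprodI G × (Σ i, ι i)))) :
    μ.real Q = ∑ A ∈ (F i).powerset, μ.real ({ω | hits f F i ω = A} ∩ Q) := by
  have h := sum_measureReal_preimage_singleton (μ := μ.restrict Q) (F i).powerset
    (f := hits f F i) fun A hA => measurableSet_hits_eq hA
  have huniv : hits f F i ⁻¹' ((F i).powerset : Set (Finset (G i))) = univ :=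
    eq_univ_of_forall fun ω => by
      classical exact Finset.mem_coe.2 (Finset.mem_powerset.2 (Finset.filter_subset _ _))
  rw [huniv, measureReal_restrict_apply MeasurableSet.univ, univ_inter] at h
  rw [← h]
  exact Finset.sum_congr rfl fun A hA =>
    measureReal_restrict_apply (measurableSet_hits_eq hA)

lemma sum_measureReal_hits_mul_card [IsProbabilityMeasure μ] (i : κ) :
    ∑ A ∈ (F i).powerset, μ.real {ω | hits f F i ω = A} * A.card =
      ∑ g ∈ F i, μ.real {ω | Conn (f i) (loc i ω) 1 g} := by
  classical
  have h : ∀ g ∈ F i, μ.real {ω | Conn (f i) (loc i ω) 1 g} = ∑ A ∈ (F i).powerset,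
      if g ∈ A then μ.real {ω | hits f F i ω = A} else 0 := by
    intro g hg
    rw [measureReal_eq_sum_hits (F := F) (f := f) i]
    refine Finset.sum_congr rfl fun A hA => ?_
    split_ifs with hgA
    · congr 1
      refine inter_eq_left.2 fun ω hω => ?_
      exact ((hits_eq_iff hA).1 hω g hg).2 hgA
    · convert measureReal_empty
      refine eq_empty_of_forall_notMem fun ω hω => hgA ?_
      exact ((hits_eq_iff hA).1 hω.1 g hg).1 hω.2
  rw [Finset.sum_congr rfl h, Finset.sum_comm]
  refine Finset.sum_congr rfl fun A hA => ?_
  rw [← Finset.sum_filter, Finset.filter_mem_eq_inter,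
    Finset.inter_eq_right.2 (Finset.mem_powerset.1 hA), Finset.sum_const, nsmul_eq_mul, mul_comm]

end Hits

variable [DecidableEq κ] [∀ i, DecidableEq (G i)]

lemma dependsOn_deep (hF : ∀ i, 1 ∉ F i) (k : ℕ) (i : κ) :
    DependsOn (Deep f F k i) {e | edgeIdx e = i} := by
  induction k generalizing i with
  | zero => exact fun _ _ _ => rfl
  | succ k ih =>
    intro ω ω' h
    simp only [Deep, eq_iff_iff]
    refine exists_congr fun g => and_congr_right fun hg => ?_
    have hl : Conn (f i) (loc i ω) 1 g = Conn (f i) (loc i ω') 1 g := dependsOn_conn_loc f i g (by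
      rintro _ ⟨e, rfl⟩
      exact h _ (edgeIdx_ofEdge i e))
    rw [hl]
    refine and_congr_right fun _ => exists_congr fun j => and_congr_right fun hj => ?_
    refine eq_iff_iff.1 ((ih j).comp_shift (CoprodI.of g) ?_)
    rintro _ ⟨e, he, rfl⟩
    refine h _ (edgeIdx_of_mul (fun h => hF i (h ▸ hg)) ?_)
    rwa [show edgeIdx e = j from he]

lemma pairwiseDisjoint_image_edgeIdx {i : κ} (T : Set (G i)) :
    (T ×ˢ {i}ᶜ : Set (G i × κ)).PairwiseDisjoint fun q =>
      (fun e : CoprodI G × (Σ i, ι i) => (CoprodI.of q.1 * e.1, e.2)) '' {e | edgeIdx e = q.2} := by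
  rintro ⟨g, j⟩ hgj ⟨g', j'⟩ hgj' hne
  simp only [Function.onFun, Set.disjoint_left]
  rintro _ ⟨e, he, rfl⟩ ⟨e', he', hee⟩
  simp only [mem_prod, mem_compl_iff, mem_singleton_iff] at hgj hgj'
  simp only [Prod.mk.injEq] at hee
  simp only [mem_ofPred_eq] at he he'
  by_cases hg : g = g'
  · subst hg
    refine hne ?_
    rw [← he, ← he', Prod.ext (mul_left_cancel hee.1) hee.2]
  · refine hgj.2 ?_
    rw [← he, ← edgeIdx_of_mul (g := g⁻¹ * g') (j := i) (e := e')
      (by rwa [ne_eq, inv_mul_eq_one]) (by rw [he']; exact hgj'.2)]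
    congr 1
    refine Prod.ext ?_ hee.2.symm
    simp [mul_assoc, hee.1]

variable [∀ i, Countable (G i)] [∀ i, Countable (ι i)] {p : ℝ}
  {μ : Measure (Config (CoprodI G × (Σ i, ι i)))} [Fintype κ]

lemma measure_hits_and_not_deep (hp : p ∈ Icc (0 : ℝ) 1) (hμ : IsBernoulli p μ)
    (hF : ∀ i, 1 ∉ F i) (k : ℕ) {i : κ} {A : Finset (G i)} (hA : A ∈ (F i).powerset) :
    μ {ω | hits f F i ω = A ∧ ∀ q ∈ A ×ˢ Finset.univ.erase i,
        ¬ Deep f F k q.2 (shift (CoprodI.of q.1) ω)} =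
      μ {ω | hits f F i ω = A} *
        (∏ j ∈ Finset.univ.erase i, μ {ω | ¬ Deep f F k j ω}) ^ A.card := by
  have := hμ.isProbabilityMeasure
  have hind := hμ.iIndepFun hp
  have hm : ∀ q : G i × κ, MeasurableSet {ω : Config (CoprodI G × (Σ i, ι i)) |
      ¬ Deep f F k q.2 (shift (CoprodI.of q.1) ω)} := fun q =>
    measurable_shift _ (measurableSet_deep k q.2).compl
  have hm' := measurableSet_finset_forall hm (A ×ˢ Finset.univ.erase i)
  have hdep : ∀ q : G i × κ, DependsOn (fun ω => ¬ Deep f F k q.2 (shift (CoprodI.of q.1) ω))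
      ((fun e : CoprodI G × (Σ i, ι i) => (CoprodI.of q.1 * e.1, e.2)) ''
        {e | edgeIdx e = q.2}) := fun q _ _ h =>
    congrArg Not ((dependsOn_deep hF k q.2).comp_shift (CoprodI.of q.1) h)
  have hdisj : Disjoint (range (ofEdge i)) (⋃ q ∈ A ×ˢ Finset.univ.erase i,
      (fun e : CoprodI G × (Σ i, ι i) => (CoprodI.of q.1 * e.1, e.2)) ''
        {e | edgeIdx e = q.2}) := by
    simp only [disjoint_iUnion_right]
    intro q hq
    refine (disjoint_range_ofEdge_image q.1).mono_right (image_mono fun e he => ?_)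
    simp only [Finset.mem_product, Finset.mem_erase] at hq
    exact fun h => hq.2.1 (he.symm.trans h)
  have hdepH : DependsOn (fun ω => hits f F i ω = A) (range (ofEdge i)) := fun _ _ h =>
    congrArg (· = A) (dependsOn_hits i h)
  rw [measure_and_of_dependsOn hind hdisj (measurableSet_hits_eq hA) hm' hdepH,
    measure_forall_of_dependsOn hind hm hdep]
  · congr 1
    rw [Finset.prod_product]
    have : ∀ (g : G i) (j : κ), μ {ω | ¬ Deep f F k j (shift (CoprodI.of g) ω)} =
        μ {ω | ¬ Deep f F k j ω} := fun g j =>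
      hμ.measure_shift hp _ (measurableSet_deep k j).compl
    simp only [this, Finset.prod_const]
  · refine (pairwiseDisjoint_image_edgeIdx (A : Set (G i))).subset fun q hq => ?_
    simpa using hq
  · intro ω ω' h
    simp only [eq_iff_iff]
    refine forall₂_congr fun q hq => eq_iff_iff.1 (hdep q fun e he => h e ?_)
    exact mem_biUnion (s := (↑(A ×ˢ Finset.univ.erase i) : Set (G i × κ))) hq he

lemma one_sub_measureReal_deep_succ_le (hp : p ∈ Icc (0 : ℝ) 1) (hμ : IsBernoulli p μ)
    (hF : ∀ i, 1 ∉ F i) (k : ℕ) (i : κ) :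
    1 - μ.real {ω | Deep f F (k + 1) i ω} ≤ ∑ A ∈ (F i).powerset,
      μ.real {ω | hits f F i ω = A} *
        (∏ j ∈ Finset.univ.erase i, (1 - μ.real {ω | Deep f F k j ω})) ^ A.card := by
  have := hμ.isProbabilityMeasure
  have hcompl : ∀ k i, μ.real {ω | ¬ Deep f F k i ω} = 1 - μ.real {ω | Deep f F k i ω} :=
    fun k i => probReal_compl_eq_one_sub (measurableSet_deep k i)
  rw [← hcompl (k + 1) i, measureReal_eq_sum_hits (f := f) (F := F) i {ω | ¬ Deep f F (k + 1) i ω}]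
  refine Finset.sum_le_sum fun A hA => ?_
  simp only [← hcompl]
  have h := congrArg ENNReal.toReal (measure_hits_and_not_deep (f := f) hp hμ hF k hA)
  rw [ENNReal.toReal_mul, ENNReal.toReal_pow, ENNReal.toReal_prod] at h
  refine le_trans (measureReal_mono ?_) h.le
  rintro ω ⟨hω, hd⟩
  refine ⟨hω, fun q hq hq' => hd ?_⟩
  simp only [Finset.mem_product, Finset.mem_erase] at hq
  have hqF := Finset.mem_powerset.1 hA hq.1
  exact ⟨q.1, hqF, ((hits_eq_iff hA).1 hω _ hqF).2 hq.1, q.2, hq.2.1, hq'⟩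

lemma exists_pos_le_measureReal_deep (hp : p ∈ Icc (0 : ℝ) 1) (hμ : IsBernoulli p μ)
    (hF : ∀ i, 1 ∉ F i) {a : κ → ℝ}
    (ha : ∀ i, a i = ∑ g ∈ F i, μ.real {ω | Conn (f i) (loc i ω) 1 g})
    (hV : 1 < ∑ i, a i / (1 + a i)) :
    ∃ i, ∃ c > 0, ∀ k, c ≤ μ.real {ω | Deep f F k i ω} := by
  have := hμ.isProbabilityMeasure
  have ha0 : ∀ i, 0 ≤ a i := fun i => by
    rw [ha]
    exact Finset.sum_nonneg fun _ _ => measureReal_nonneg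
  set v : κ → ℝ := fun i => a i / (1 + a i) with hv
  have hv0 : ∀ i, 0 ≤ v i := fun i => div_nonneg (ha0 i) (by linarith [ha0 i])
  have hv1 : ∀ i, v i ≤ 1 := fun i => div_le_one_of_le₀ (by linarith) (by linarith [ha0 i])
  obtain ⟨ε, hε, hε1, H⟩ := exists_pos_mul_le (v := v) (fun i => ((F i).card : ℝ)) ha0
    (fun _ => rfl) hV
  obtain ⟨i₀, hi₀⟩ : ∃ i, 0 < v i := by
    by_contra! h
    linarith [Finset.sum_nonpos fun i (_ : i ∈ Finset.univ) => h i]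
  refine ⟨i₀, ε * v i₀, mul_pos hε hi₀, fun k => ?_⟩
  generalize i₀ = i
  induction k generalizing i with
  | zero =>
    have : {ω | Deep f F 0 i ω} = univ := eq_univ_of_forall fun _ => trivial
    rw [this, probReal_univ]
    exact mul_le_one₀ hε1 (hv0 i) (hv1 i)
  | succ k ih =>
    rcases H i with h0 | H
    · rw [h0, mul_zero]
      exact measureReal_nonneg
    obtain ⟨W, hW⟩ : ∃ W, W = ∑ j ∈ Finset.univ.erase i, v j := ⟨_, rfl⟩
    rw [← hW] at H
    have hW0 : 0 ≤ W := hW ▸ Finset.sum_nonneg fun j _ => hv0 j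
    have h1 : ∀ j, μ.real {ω | Deep f F k j ω} ≤ 1 := fun j => measureReal_le_one
    have hprod : ∏ j ∈ Finset.univ.erase i, (1 - μ.real {ω | Deep f F k j ω}) ≤
        Real.exp (-(ε * W)) := by
      rw [hW, Finset.mul_sum, ← Finset.sum_neg_distrib, Real.exp_sum]
      refine Finset.prod_le_prod (fun j _ => by linarith [h1 j])
        fun j _ => ?_
      linarith [ih j, Real.add_one_le_exp (-(ε * v j))]
    have hprod0 : 0 ≤ ∏ j ∈ Finset.univ.erase i, (1 - μ.real {ω | Deep f F k j ω}) :=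
      Finset.prod_nonneg fun j _ => by linarith [h1 j]
    have hpow : ∀ A ∈ (F i).powerset,
        (∏ j ∈ Finset.univ.erase i, (1 - μ.real {ω | Deep f F k j ω})) ^ A.card ≤
          1 - ε * W * A.card + (ε * W * (F i).card) ^ 2 := by
      intro A hA
      have hcard : (A.card : ℝ) ≤ (F i).card :=
        Nat.cast_le.2 (Finset.card_le_card (Finset.mem_powerset.1 hA))
      refine (pow_le_pow_left₀ hprod0 hprod _).trans ?_
      rw [← Real.exp_nat_mul, mul_neg, mul_comm]
      refine (exp_neg_le (by positivity)).trans ?_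
      gcongr
    have htot : ∑ A ∈ (F i).powerset, μ.real {ω | hits f F i ω = A} = 1 := by
      have := measureReal_eq_sum_hits (μ := μ) (f := f) (F := F) i univ
      simpa using this.symm
    have hmean := sum_measureReal_hits_mul_card (μ := μ) (f := f) (F := F) i
    rw [← ha] at hmean
    have hle := (one_sub_measureReal_deep_succ_le (f := f) hp hμ hF k i).trans
      (Finset.sum_le_sum fun A hA => mul_le_mul_of_nonneg_left (hpow A hA) measureReal_nonneg)
    have heq : ∑ A ∈ (F i).powerset, μ.real {ω | hits f F i ω = A} *
        (1 - ε * W * A.card + (ε * W * (F i).card) ^ 2) =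
          1 - ε * W * a i + (ε * W * (F i).card) ^ 2 := by
      calc _ = (∑ A ∈ (F i).powerset, μ.real {ω | hits f F i ω = A}) *
              (1 + (ε * W * (F i).card) ^ 2) - ε * W *
                ∑ A ∈ (F i).powerset, μ.real {ω | hits f F i ω = A} * A.card := by
            rw [Finset.sum_mul, Finset.mul_sum, ← Finset.sum_sub_distrib]
            exact Finset.sum_congr rfl fun A _ => by ring
        _ = _ := by
            rw [htot, hmean]
            ring
    rw [heq] at hle
    nlinarith [mul_le_mul_of_nonneg_left H hε.le]

lemma theta_pos (hp : p ∈ Icc (0 : ℝ) 1) (hμ : IsBernoulli p μ)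
    {ν : ∀ i, Measure (Config (G i × ι i))} (hν : ∀ i, IsBernoulli p (ν i))
    (hsum : ∑ i, invChi (f i) (ν i) < (Fintype.card κ : ℝ) - 1) :
    0 < theta (freeGens f) μ := by
  have := hμ.isProbabilityMeasure
  obtain ⟨η, hη, hηs⟩ : ∃ η > 0, ∑ i, (invChi (f i) (ν i) + η) < (Fintype.card κ : ℝ) - 1 := by
    have ht : Tendsto (fun η : ℝ => ∑ i, (invChi (f i) (ν i) + η)) (𝓝[>] 0)
        (𝓝 (∑ i, invChi (f i) (ν i))) := by
      have : Continuous fun η : ℝ => ∑ i, (invChi (f i) (ν i) + η) := by fun_prop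
      simpa using (this.tendsto 0).mono_left nhdsWithin_le_nhds
    exact ((eventually_mem_nhdsWithin (α := ℝ)).and (ht.eventually_lt_const hsum)).exists
  have hT : ∀ i, ∃ T : Finset (G i), 1 ∈ T ∧
      1 / ∑ g ∈ T, μ.real {ω | Conn (f i) (loc i ω) 1 g} < invChi (f i) (ν i) + η := by
    intro i
    have ht : Tendsto (fun T : Finset (G i) =>
        1 / ∑ g ∈ T, μ.real {ω | Conn (f i) (loc i ω) 1 g}) atTop (𝓝 (invChi (f i) (ν i))) := by
      have := (hν i).isProbabilityMeasure
      have hchi : chi (f i) (ν i) ≠ 0 := (zero_lt_one.trans_le (one_le_chi _ _)).ne'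
      have h := (ENNReal.summable (f := fun g : G i => ν i {ω | Conn (f i) ω 1 g})).hasSum
      rw [← chi_eq_tsum] at h
      have h' := (ENNReal.tendsto_toReal (ENNReal.inv_ne_top.2 hchi)).comp
        (tendsto_inv_iff.2 h)
      refine h'.congr fun T => ?_
      simp only [Function.comp_apply]
      rw [ENNReal.toReal_inv, one_div, ENNReal.toReal_sum]
      · congr 1
        refine Finset.sum_congr rfl fun g _ => ?_
        rw [measureReal_def, hμ.measure_loc hp i (hν i) (measurableSet_conn (f i) 1 g)]
      · exact fun _ _ => measure_ne_top _ _
    obtain ⟨T, h1, h2⟩ := ((eventually_ge_atTop {1}).and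
      (ht.eventually_lt_const (lt_add_of_pos_right _ hη))).exists
    exact ⟨T, h1 (Finset.mem_singleton_self 1), h2⟩
  choose T hT1 hT2 using hT
  set F : ∀ i, Finset (G i) := fun i => (T i).erase 1 with hFdef
  have hF : ∀ i, 1 ∉ F i := fun i => Finset.notMem_erase 1 (T i)
  set a : κ → ℝ := fun i => ∑ g ∈ F i, μ.real {ω | Conn (f i) (loc i ω) 1 g} with ha
  have haT : ∀ i, 1 + a i = ∑ g ∈ T i, μ.real {ω | Conn (f i) (loc i ω) 1 g} := by
    intro i
    rw [← Finset.add_sum_erase _ _ (hT1 i)]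
    congr 1
    have : {ω : Config (CoprodI G × (Σ i, ι i)) | Conn (f i) (loc i ω) 1 1} = univ :=
      eq_univ_of_forall fun _ => Relation.ReflTransGen.refl
    rw [this, probReal_univ]
  have ha0 : ∀ i, 0 ≤ a i := fun i => Finset.sum_nonneg fun _ _ => measureReal_nonneg
  have hV : 1 < ∑ i, a i / (1 + a i) := by
    have h1 : ∀ i, a i / (1 + a i) = 1 - 1 / (1 + a i) := fun i => by
      have : 1 + a i ≠ 0 := by linarith [ha0 i]
      field_simp
      ring
    have h2 : ∑ i, 1 / (1 + a i) ≤ ∑ i, (invChi (f i) (ν i) + η) :=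
      Finset.sum_le_sum fun i _ => by
        rw [haT]
        exact (hT2 i).le
    simp only [h1, Finset.sum_sub_distrib, Finset.sum_const, Finset.card_univ, nsmul_eq_mul,
      mul_one]
    linarith
  obtain ⟨i, c, hc, hle⟩ := exists_pos_le_measureReal_deep hp hμ hF (fun i => rfl) hV
  have hanti : Antitone fun k => {ω | Deep f F k i ω} :=
    antitone_nat_of_succ_le fun k ω h => Deep.of_succ h
  have hlim := tendsto_measure_iInter_atTop (μ := μ)
    (fun k => (measurableSet_deep (f := f) (F := F) k i).nullMeasurableSet) hanti
    ⟨0, measure_ne_top _ _⟩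
  have hge : ENNReal.ofReal c ≤ μ (⋂ k, {ω | Deep f F k i ω}) :=
    ge_of_tendsto' hlim fun k => (ENNReal.ofReal_le_iff_le_toReal (measure_ne_top _ _)).2 (hle k)
  refine ENNReal.toReal_pos (ne_of_gt ?_) (measure_ne_top _ _)
  refine (ENNReal.ofReal_pos.2 hc).trans_le (hge.trans (measure_mono fun ω hω => ?_))
  exact infinite_cluster_of_deep hF fun k => mem_iInter.1 hω k

end Supercritical

end Perc

/-- For `n ≥ 2` nontrivial finitely generated groups `Gᵢ` with finite
generating sets `Sᵢ`, there is a unique `p₀ ∈ (0,1]` with `∑ᵢ 1/χᵢ(p₀) = n - 1` (in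
`[0,∞]`, so that `1/∞ = 0`), and `p₀` is the critical probability of the Cayley graph of
the free product `G₁ * ⋯ * G_n` w.r.t. `S₁ ⊔ ⋯ ⊔ S_n`. -/
theorem critical_probability_free_product
    {n : ℕ} (hn : 2 ≤ n) {G : Fin n → Type*} [∀ i, Group (G i)] [∀ i, Nontrivial (G i)]
    (S : ∀ i, Set (G i)) (hfin : ∀ i, (S i).Finite)
    (hgen : ∀ i, Subgroup.closure (S i) = ⊤)
    (μi : ∀ i, ℝ → Measure (Config (G i × S i)))
    (μ : ℝ → Measure (Config (Monoid.CoprodI G × (Σ i, S i))))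
    (hμi : ∀ i, ∀ p ∈ Set.Icc (0 : ℝ) 1, IsBernoulli p (μi i p))
    (hμ : ∀ p ∈ Set.Icc (0 : ℝ) 1, IsBernoulli p (μ p)) :
    (∃! p₀ : ℝ, p₀ ∈ Set.Ioc (0 : ℝ) 1 ∧
      ∑ i : Fin n, (chi (setGens (S i)) (μi i p₀))⁻¹ = (n : ℝ≥0∞) - 1) ∧
    pc (coprodIGens S) μ ∈ Set.Ioc (0 : ℝ) 1 ∧
    ∑ i : Fin n, (chi (setGens (S i)) (μi i (pc (coprodIGens S) μ)))⁻¹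
      = (n : ℝ≥0∞) - 1 := by
  classical
  have (i : Fin n) : Fintype (S i) := (hfin i).fintype
  have : Nontrivial (Fin n) := Fin.nontrivial_iff_two_le.2 hn
  have hn' : (2 : ℝ) ≤ n := by exact_mod_cast hn
  let f : ∀ i, S i → G i := fun i => setGens (S i)
  have hf : ∀ i, Subgroup.closure (Set.range (f i)) = ⊤ := fun i => by
    simpa [f, setGens] using hgen i
  have (i : Fin n) : Countable (G i) := countable_of_closure_range_eq_top (f i) (hf i)
  have hIcc : ∀ {p : ℝ}, p ∈ Set.Ioc (0 : ℝ) 1 → p ∈ Set.Icc (0 : ℝ) 1 := fun h => ⟨h.1.le, h.2⟩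
  obtain ⟨p₀, hp₀, hsum⟩ := exists_sum_invChi_eq hn hf hμi
  have heq := (sum_chi_inv_eq_iff (f := f) (by lia) hμi (hIcc hp₀)).2 hsum
  have hgt : ∀ q ∈ Set.Icc (0 : ℝ) 1, p₀ < q → ∑ i, invChi (f i) (μi i q) < n - 1 :=
    fun q hq h => hsum ▸ sum_invChi_lt hf hμi (hIcc hp₀) hq h (by linarith)
  have hlt : ∀ q ∈ Set.Icc (0 : ℝ) 1, q < p₀ → n - 1 < ∑ i, invChi (f i) (μi i q) := by
    intro q hq h
    have hle : ∑ i, invChi (f i) (μi i p₀) ≤ ∑ i, invChi (f i) (μi i q) :=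
      Finset.sum_le_sum fun i _ => antitoneOn_invChi (hμi i) hq (hIcc hp₀) h.le
    exact hsum ▸ sum_invChi_lt hf hμi hq (hIcc hp₀) h (by linarith)
  have hpc : pc (coprodIGens S) μ = p₀ := by
    have hbdd : BddBelow ({p | p ∈ Set.Icc (0 : ℝ) 1 ∧ 0 < theta (coprodIGens S) (μ p)} ∪ {1}) :=
      ⟨0, by rintro q (⟨hq, -⟩ | rfl); exacts [hq.1, zero_le_one]⟩
    refine le_antisymm (le_of_forall_gt_imp_ge_of_dense fun q hq => ?_) (le_csInf ⟨1, .inr rfl⟩ ?_)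
    · rcases le_or_gt q 1 with hq1 | hq1
      · have hqI : q ∈ Set.Icc (0 : ℝ) 1 := ⟨(hp₀.1.trans hq).le, hq1⟩
        refine csInf_le hbdd (.inl ⟨hqI, ?_⟩)
        exact theta_pos (f := f) hqI (hμ q hqI) (fun i => hμi i q hqI) (by simpa using hgt q hqI hq)
      · exact (csInf_le hbdd (.inr rfl)).trans hq1.le
    · rintro q (⟨hq, hθ⟩ | rfl)
      · by_contra! h
        exact hθ.ne' (theta_eq_zero (f := f) hq (hμ q hq) (fun i => hμi i q hq)
          (by simpa using hlt q hq h))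
      · exact hp₀.2
  rw [hpc]
  refine ⟨⟨p₀, ⟨hp₀, heq⟩, fun q hq => ?_⟩, hp₀, heq⟩
  have hq' := (sum_chi_inv_eq_iff (f := f) (by lia) hμi (hIcc hq.1)).1 hq.2
  rcases lt_trichotomy q p₀ with h | h | h
  · exact absurd hq' (hlt q (hIcc hq.1) h).ne'
  · exact h
  · exact absurd hq' (hgt q (hIcc hq.1) h).ne
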